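/- Let H be a geometric complete multipartite graph on a point set P with coloring φ, and let C be a plane cycle of length t ≥ 6 through all points of P. Suppose that every segment between two points of P of different colors that is not an edge of C crosses some edge of C (equivalently, every chord of C that crosses no edge of C has both endpoints of the same color). Then there exist four cyclically consecutive points c, a, b, d of C such that φ(c) ≠ φ(d) and such that deleting a and b from C and joining c to d by the segment [c,d] yields a plane cycle of length t − 2 in H. -/

import Mathlib

noncomputable section

/-- Points of the plane. -/
abbrev Pt : Type := ℝ × ℝ

/-- Signed side of point `p` with respect to the oriented line through `u` and `u'`
(the usual cross-product / determinant test). -/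
def sideSign (u u' p : Pt) : ℝ :=
  (u'.1 - u.1) * (p.2 - u.2) - (u'.2 - u.2) * (p.1 - u.1)

/-- `v` and `v'` lie on strictly opposite sides of the straight line through `u` and `u'`. -/
def StrictlyOppositeSides (u u' v v' : Pt) : Prop :=
  sideSign u u' v * sideSign u u' v' < 0

/-- A set of points is in general position: no three (distinct) points of it are collinear. -/
def GenPos (P : Set Pt) : Prop :=
  ∀ a ∈ P, ∀ b ∈ P, ∀ c ∈ P, a ≠ b → a ≠ c → b ≠ c →
    ¬ Collinear ℝ ({a, b, c} : Set Pt)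

/-- `γ : ZMod t → Pt` is a plane cycle of length `t` for the coloring `φ`:
a cyclic sequence of `t ≥ 3` distinct points in which cyclically consecutive points have
different colors, and in which two distinct edges meet exactly in their common endpoint
if they are cyclically consecutive, and not at all otherwise. -/
def IsPlaneCycle (φ : Pt → ℕ) (t : ℕ) (γ : ZMod t → Pt) : Prop :=
  3 ≤ t ∧ Function.Injective γ ∧
  (∀ i : ZMod t, φ (γ i) ≠ φ (γ (i + 1))) ∧
  ∀ i j : ZMod t, i ≠ j →
    (j = i + 1 →
      segment ℝ (γ i) (γ (i + 1)) ∩ segment ℝ (γ j) (γ (j + 1)) = ({γ (i + 1)} : Set Pt)) ∧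
    (j ≠ i + 1 → i ≠ j + 1 →
      segment ℝ (γ i) (γ (i + 1)) ∩ segment ℝ (γ j) (γ (j + 1)) = (∅ : Set Pt))

/-- A cycle is non-rainbow if some color appears on two of its points. -/
def NonRainbow (φ : Pt → ℕ) (t : ℕ) (γ : ZMod t → Pt) : Prop :=
  ∃ i j : ZMod t, i ≠ j ∧ φ (γ i) = φ (γ j)

/-- A set of points is in convex position (each point is a vertex of the convex hull). -/
def ConvexPosition (s : Set Pt) : Prop :=
  ∀ p ∈ s, p ∉ convexHull ℝ (s \ {p})

/-- The unordered pair `{p, q}` is an edge of the cycle `γ`. -/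
def IsEdgeOf (t : ℕ) (γ : ZMod t → Pt) (p q : Pt) : Prop :=
  ∃ i : ZMod t, (p = γ i ∧ q = γ (i + 1)) ∨ (q = γ i ∧ p = γ (i + 1))

/-- The segment `[a,b]` crosses the segment `[p,q]`: they intersect in a point which is not
an endpoint shared by both segments. -/
def Crosses (a b p q : Pt) : Prop :=
  ∃ x : Pt, x ∈ segment ℝ a b ∧ x ∈ segment ℝ p q ∧
    ¬ (x ∈ ({a, b} : Set Pt) ∧ x ∈ ({p, q} : Set Pt))

section Geo

variable {ι : Type} (z : ι → Pt)

def dd (i j k : ι) : ℝ := sideSign (z i) (z j) (z k)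

def GP : Prop := ∀ i j k : ι, i ≠ j → i ≠ k → j ≠ k → dd z i j k ≠ 0

def XX (i j k l : ι) : Prop :=
  dd z i j k * dd z i j l < 0 ∧ dd z k l i * dd z k l j < 0

def Ins (x a b c : ι) : Prop :=
  (0 < dd z a b x ∧ 0 < dd z b c x ∧ 0 < dd z c a x) ∨
  (dd z a b x < 0 ∧ dd z b c x < 0 ∧ dd z c a x < 0)

theorem dd_rot (i j k : ι) : dd z i j k = dd z j k i := by
  simp only [dd, sideSign]; ring
theorem dd_swap (i j k : ι) : dd z i j k = - dd z j i k := by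
  simp only [dd, sideSign]; ring
theorem dd_swap' (i j k : ι) : dd z i j k = - dd z i k j := by
  simp only [dd, sideSign]; ring
theorem dd_self (i j : ι) : dd z i i j = 0 := by
  simp only [dd, sideSign]; ring
theorem dd_self1 (i j : ι) : dd z i j i = 0 := by
  simp only [dd, sideSign]; ring
theorem dd_self2 (i j : ι) : dd z i j j = 0 := by
  simp only [dd, sideSign]; ring
theorem dd_sum (p i j k : ι) : dd z i j k = dd z p i j + dd z p j k + dd z p k i := by
  simp only [dd, sideSign]; ring
theorem dd_plu (u a b c d : ι) :
    dd z u a b * dd z u c d - dd z u a c * dd z u b d + dd z u a d * dd z u b c = 0 := by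
  simp only [dd, sideSign]; ring

/-- barycentric identity for the affine function `dd c d` -/
theorem dd_bary (p q r c d x : ι) :
    dd z p q r * dd z c d x =
      dd z q r x * dd z c d p + dd z r p x * dd z c d q + dd z p q x * dd z c d r := by
  simp only [dd, sideSign]; ring

/-- the crossing point identity -/
theorem dd_cr (p s c d e f : ι) :
    dd z p s d * dd z e f c - dd z p s c * dd z e f d =
      (dd z p s d - dd z p s c - dd z p c d) * dd z e f p + dd z p c d * dd z e f s := by
  simp only [dd, sideSign]; ring

variable {z}

theorem XX.symm1 {i j k l : ι} (h : XX z i j k l) : XX z j i k l := by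
  unfold XX at *
  rw [dd_swap z j i k, dd_swap z j i l]
  constructor <;> nlinarith [h.1, h.2]

theorem XX.symm2 {i j k l : ι} (h : XX z i j k l) : XX z k l i j := ⟨h.2, h.1⟩

theorem XX.symm3 {i j k l : ι} (h : XX z i j k l) : XX z i j l k := h.symm2.symm1.symm2

theorem XX.orient {p s c d : ι} (h : XX z p s c d) :
    (dd z p s c < 0 ∧ 0 < dd z p s d ∧ 0 < dd z p c d ∧
      dd z p c d < dd z p s d - dd z p s c) ∨
    (dd z p s d < 0 ∧ 0 < dd z p s c ∧ 0 < dd z p d c ∧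
      dd z p d c < dd z p s c - dd z p s d) := by
  obtain ⟨h1, h2⟩ := h
  have e1 : dd z c d p = dd z p c d := by rw [dd_rot z p c d]
  have e2 : dd z c d s = dd z p c d - dd z p s d + dd z p s c := by
    rw [dd_sum z p c d s, dd_swap' z p d s]; ring
  have e3 : dd z p d c = - dd z p c d := by rw [dd_swap']
  rw [e1, e2] at h2
  rw [e3]
  rcases mul_neg_iff.1 h1 with ⟨a, b⟩ | ⟨a, b⟩ <;>
    rcases mul_neg_iff.1 h2 with ⟨c, d⟩ | ⟨c, d⟩
  · exfalso; linarith
  · right; refine ⟨b, a, ?_, ?_⟩ <;> linarith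
  · left; refine ⟨a, b, c, ?_⟩; linarith
  · exfalso; linarith

theorem XX.of_orient {p s c d : ι} (h1 : dd z p s c < 0) (h2 : 0 < dd z p s d)
    (h3 : 0 < dd z p c d) (h4 : dd z p c d < dd z p s d - dd z p s c) : XX z p s c d := by
  have e1 : dd z c d p = dd z p c d := by rw [dd_rot z p c d]
  have e2 : dd z c d s = dd z p c d - dd z p s d + dd z p s c := by
    rw [dd_sum z p c d s, dd_swap' z p d s]; ring
  refine ⟨mul_neg_of_neg_of_pos h1 h2, ?_⟩
  rw [e1, e2]
  exact mul_neg_of_pos_of_neg h3 (by linarith)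

theorem dd_ne_imp {i j k : ι} (h : dd z i j k ≠ 0) : i ≠ j ∧ i ≠ k ∧ j ≠ k := by
  refine ⟨?_, ?_, ?_⟩ <;> rintro rfl
  · exact h (dd_self z _ _)
  · exact h (dd_self1 z _ _)
  · exact h (dd_self2 z _ _)

theorem Ins.rot {x a b c : ι} (h : Ins z x a b c) : Ins z x b c a := by
  rcases h with ⟨h1, h2, h3⟩ | ⟨h1, h2, h3⟩
  · exact Or.inl ⟨h2, h3, h1⟩
  · exact Or.inr ⟨h2, h3, h1⟩

theorem Ins.swap {x a b c : ι} (h : Ins z x a b c) : Ins z x b a c := by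
  unfold Ins at *
  rw [dd_swap z b a x, dd_swap z a c x, dd_swap z c b x]
  rcases h with ⟨h1, h2, h3⟩ | ⟨h1, h2, h3⟩
  · right; refine ⟨?_, ?_, ?_⟩ <;> linarith
  · left; refine ⟨?_, ?_, ?_⟩ <;> linarith

theorem exit_core (gp : GP z) {p q r a b : ι} (hab : a ≠ b) (h : XX z a b q r)
    (hp : 0 < dd z q r p) (ha : 0 < dd z q r a) (hap : a ≠ p) :
    Ins z a p q r ∨ XX z a b p q ∨ XX z a b p r := by
  obtain ⟨h1, h2⟩ := h
  have hb : dd z q r b < 0 := by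
    rcases mul_neg_iff.1 h2 with ⟨x, y⟩ | ⟨x, y⟩
    · exact y
    · linarith
  have hbp : b ≠ p := by rintro rfl; linarith
  have id0 : dd z a b r - dd z a b q = dd z q r a - dd z q r b := by
    simp only [dd, sideSign]; ring
  have hqr : dd z a b q < 0 ∧ 0 < dd z a b r := by
    rcases mul_neg_iff.1 h1 with ⟨x, y⟩ | ⟨x, y⟩
    · linarith
    · exact ⟨x, y⟩
  obtain ⟨hq, hr⟩ := hqr
  have nqra := dd_ne_imp ha.ne'
  have nqrp := dd_ne_imp hp.ne'
  have epqr : dd z p q r = dd z q r p := dd_rot z p q r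
  have bary := dd_bary z p q r a b a
  rw [dd_self1, mul_zero] at bary
  have idF : dd z q r a * dd z p q b - dd z q r b * dd z p q a
      = - dd z a b q * dd z p q r := by
    simp only [dd, sideSign]; ring
  have idG : dd z q r a * dd z r p b - dd z q r b * dd z r p a
      = dd z a b r * dd z p q r := by
    simp only [dd, sideSign]; ring
  have hF : dd z p q a ≠ 0 := gp _ _ _ nqrp.2.1.symm hap.symm nqra.2.1
  have hG : dd z r p a ≠ 0 := gp _ _ _ nqrp.2.2 nqra.2.2 hap.symm
  rcases lt_or_gt_of_ne (gp a b p hab hap hbp) with hc | hc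
  · rcases lt_or_gt_of_ne hG with hg | hg
    · right; right
      have : 0 < dd z r p b := by
        have e1 : 0 < dd z q r b * dd z r p a := mul_pos_of_neg_of_neg hb hg
        have e2 : 0 < dd z a b r * dd z p q r := mul_pos hr (by linarith)
        exact pos_of_mul_pos_right (by linarith : 0 < dd z q r a * dd z r p b) ha.le
      refine XX.symm3 ⟨mul_neg_of_pos_of_neg hr hc, mul_neg_of_neg_of_pos hg this⟩
    · left; left
      refine ⟨?_, ha, hg⟩
      have e1 : dd z q r a * dd z a b p < 0 := mul_neg_of_pos_of_neg ha hc
      have e2 : dd z r p a * dd z a b q < 0 := mul_neg_of_pos_of_neg hg hq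
      exact pos_of_mul_pos_left (by linarith : 0 < dd z p q a * dd z a b r) hr.le
  · rcases lt_or_gt_of_ne hF with hg | hg
    · right; left
      have : 0 < dd z p q b := by
        have e1 : 0 < dd z q r b * dd z p q a := mul_pos_of_neg_of_neg hb hg
        have e2 : 0 < - dd z a b q * dd z p q r := mul_pos (by linarith) (by linarith)
        exact pos_of_mul_pos_right (by linarith : 0 < dd z q r a * dd z p q b) ha.le
      exact ⟨mul_neg_of_pos_of_neg hc hq, mul_neg_of_neg_of_pos hg this⟩
    · left; left
      refine ⟨hg, ha, ?_⟩
      have e1 : 0 < dd z q r a * dd z a b p := mul_pos ha hc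
      have e2 : 0 < dd z p q a * dd z a b r := mul_pos hg hr
      by_contra hn
      have e3 : 0 ≤ dd z r p a * dd z a b q :=
        mul_nonneg_of_nonpos_of_nonpos (not_lt.1 hn) hq.le
      linarith

theorem exit_lem (gp : GP z) {p q r a b : ι} (hab : a ≠ b) (h : XX z a b q r)
    (hp : 0 < dd z q r p * dd z q r a) (hap : a ≠ p) :
    Ins z a p q r ∨ XX z a b p q ∨ XX z a b p r := by
  rcases pos_and_pos_or_neg_and_neg_of_mul_pos hp with ⟨h1, h2⟩ | ⟨h1, h2⟩
  · exact exit_core gp hab h h1 h2 hap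
  · rw [dd_swap] at h1 h2
    rcases exit_core gp hab h.symm3 (by linarith) (by linarith) hap with h | h | h
    · left; exact h.rot.swap.rot.rot
    · right; right; exact h
    · right; left; exact h

variable (z) in
structure Mx (M : ι → ι → Prop) : Prop where
  symm : ∀ i j, M i j → M j i
  irr : ∀ i j, M i j → i ≠ j
  nc : ∀ i j k l, M i j → M k l → ¬ XX z i j k l
  mx : ∀ i j, i ≠ j → (∀ k l, M k l → ¬ XX z i j k l) → M i j

variable (z) in
def Tri (M : ι → ι → Prop) (p q r : ι) : Prop :=
  M p q ∧ M q r ∧ M r p ∧ ∀ k, ¬ Ins z k p q r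

variable {M : ι → ι → Prop}

theorem Tri.rot {p q r : ι} (h : Tri z M p q r) : Tri z M q r p :=
  ⟨h.2.1, h.2.2.1, h.1, fun k hk => h.2.2.2 k hk.rot.rot⟩

theorem Tri.swap (mx : Mx z M) {p q r : ι} (h : Tri z M p q r) : Tri z M q p r :=
  ⟨mx.symm _ _ h.1, mx.symm _ _ h.2.2.1, mx.symm _ _ h.2.1, fun k hk => h.2.2.2 k hk.swap⟩

/-- first element in angular order around `p` starting from `q`. -/
theorem exists_first [Finite ι] (gp : GP z) {p q : ι} (K : Set ι) (hK : K.Nonempty)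
    (hL : ∀ k ∈ K, 0 < dd z p q k) :
    ∃ s ∈ K, ∀ k ∈ K, k ≠ s → 0 < dd z p s k := by
  obtain ⟨k0, hk0⟩ := hK
  obtain ⟨s, hs, hmin⟩ := Set.exists_min_image K (fun k => dd z p k0 k / dd z p q k)
    (Set.toFinite K) ⟨k0, hk0⟩
  refine ⟨s, hs, fun k hk hks => ?_⟩
  have h1 := hmin k hk
  have h2 := hL s hs
  have h3 := hL k hk
  have h4 := hL k0 hk0
  rw [div_le_div_iff₀ h2 h3] at h1
  have h5 := dd_plu z p k0 q s k
  have h6 := dd_swap' z p k0 q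
  have hne : dd z p s k ≠ 0 :=
    gp _ _ _ (dd_ne_imp h2.ne').2.1 (dd_ne_imp h3.ne').2.1 hks.symm
  rcases lt_or_gt_of_ne hne with h | h
  · have : 0 < dd z p k0 q * dd z p s k := mul_pos_of_neg_of_neg (by linarith) h
    linarith
  · exact h

end Geo
section Geo2

variable {ι : Type} {z : ι → Pt} {M : ι → ι → Prop}

theorem Mx.block (mx : Mx z M) {i j : ι} (hij : i ≠ j) (hn : ¬ M i j) :
    ∃ c d, M c d ∧ dd z i j c < 0 ∧ 0 < dd z i j d ∧ 0 < dd z i c d ∧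
      dd z i c d < dd z i j d - dd z i j c := by
  by_contra hcon
  push Not at hcon
  apply hn
  apply mx.mx _ _ hij
  intro k l hkl hX
  rcases hX.orient with ⟨h1, h2, h3, h4⟩ | ⟨h1, h2, h3, h4⟩
  · exact absurd h4 (not_lt.2 (hcon k l hkl h1 h2 h3))
  · exact absurd h4 (not_lt.2 (hcon l k (mx.symm _ _ hkl) h1 h2 h3))

theorem exists_nbr [Finite ι] (gp : GP z) (mx : Mx z M) {p q : ι}
    (hk : ∃ k, 0 < dd z p q k) : ∃ k, M p k ∧ 0 < dd z p q k := by
  obtain ⟨s, hs, hsf⟩ := exists_first gp {k | 0 < dd z p q k} hk (fun k hk => hk)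
  simp only [Set.mem_ofPred_eq] at hs hsf
  by_cases hps : M p s
  · exact ⟨s, hps, hs⟩
  have nps : p ≠ s := (dd_ne_imp hs.ne').2.1
  obtain ⟨c0, d0, hcd0⟩ := mx.block nps hps
  obtain ⟨⟨b, a⟩, ⟨hMba, hsb, hsa, hba, hlt⟩, hmin⟩ := Set.exists_min_image
    {x : ι × ι | M x.1 x.2 ∧ dd z p s x.1 < 0 ∧ 0 < dd z p s x.2 ∧ 0 < dd z p x.1 x.2 ∧
      dd z p x.1 x.2 < dd z p s x.2 - dd z p s x.1}
    (fun x => dd z p x.1 x.2 / (dd z p s x.2 - dd z p s x.1)) (Set.toFinite _)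
    ⟨(c0, d0), hcd0⟩
  simp only at hMba hsb hsa hba hlt
  have hqb : dd z p q b ≤ 0 := by
    by_contra h
    push Not at h
    have : b ≠ s := by rintro rfl; rw [dd_self2] at hsb; exact lt_irrefl _ hsb
    linarith [hsf b h this]
  have hqa : 0 < dd z p q a := by
    have e := dd_plu z p q s b a
    have e1 : 0 < dd z p q s * dd z p b a := mul_pos hs hba
    have e2 : dd z p q b * dd z p s a ≤ 0 := mul_nonpos_of_nonpos_of_nonneg hqb hsa.le
    by_contra h
    have : 0 ≤ dd z p q a * dd z p s b :=
      mul_nonneg_of_nonpos_of_nonpos (not_lt.1 h) hsb.le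
    linarith
  obtain ⟨s', ⟨hs'L, hs'K⟩, hs'f⟩ := exists_first gp
    {k | 0 < dd z p q k ∧ (0 < dd z b a k ∨ k = a)} ⟨a, hqa, Or.inr rfl⟩ (fun k hk => hk.1)
  simp only [Set.mem_ofPred_eq] at hs'f
  by_cases hps' : M p s'
  · exact ⟨s', hps', hs'L⟩
  exfalso
  have nps' : p ≠ s' := (dd_ne_imp hs'L.ne').2.1
  obtain ⟨c, d, hMcd, hc, hd, hcd, hclt⟩ := mx.block nps' hps'
  -- values of the affine functions
  have Bp : dd z b a p = dd z p b a := (dd_rot z p b a).symm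
  have Bs : dd z b a s = dd z p b a - dd z p s a + dd z p s b := by
    rw [dd_sum z p b a s, dd_swap' z p a s]; ring
  have Bs' : 0 ≤ dd z b a s' := by
    rcases hs'K with h | h
    · exact h.le
    · rw [h, dd_self2]
  have Cp : dd z c d p = dd z p c d := (dd_rot z p c d).symm
  have Cs : dd z c d s = dd z p c d - dd z p s d + dd z p s c := by
    rw [dd_sum z p c d s, dd_swap' z p d s]; ring
  have Cs' : dd z c d s' < 0 := by
    rw [dd_sum z p c d s', dd_swap' z p d s']; linarith
  have hs's : s' ≠ s := by
    rintro rfl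
    linarith
  have hss' : 0 < dd z p s s' := hsf s' hs'L hs's
  have hs'a : 0 ≤ dd z p s' a := by
    by_cases h : a = s'
    · rw [h, dd_self2]
    · exact (hs'f a ⟨hqa, Or.inr rfl⟩ h).le
  have hbs : 0 < dd z p b s := by rw [dd_swap']; linarith
  have hbs' : 0 < dd z p b s' := by
    have e := dd_plu z p b s s' a
    have e1 : 0 ≤ dd z p b s * dd z p s' a := mul_nonneg hbs.le hs'a
    have e2 : 0 < dd z p b a * dd z p s s' := mul_pos hba hss'
    exact pos_of_mul_pos_left (by linarith : 0 < dd z p b s' * dd z p s a) hsa.le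
  have star : 0 < dd z p s' d * dd z b a c - dd z p s' c * dd z b a d := by
    rw [dd_cr, Bp]
    have e1 : 0 < (dd z p s' d - dd z p s' c - dd z p c d) * dd z p b a :=
      mul_pos (by linarith) hba
    have e2 : 0 ≤ dd z p c d * dd z b a s' := mul_nonneg hcd.le Bs'
    linarith
  -- barycentric for s'
  have id1 : dd z p b a * dd z c d s' =
      dd z b a s' * dd z c d p + dd z p s' a * dd z c d b + dd z p b s' * dd z c d a := by
    rw [dd_bary z p b a c d s', dd_rot z p s' a, dd_rot z s' a p]
  have id1n : dd z p b a * dd z c d s' < 0 := mul_neg_of_pos_of_neg hba Cs'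
  have e1 : 0 ≤ dd z b a s' * dd z c d p := mul_nonneg Bs' (by linarith)
  have nX := mx.nc _ _ _ _ hMcd hMba
  have ncd := mx.irr _ _ hMcd
  have nba := mx.irr _ _ hMba
  have ncs' : c ≠ s' := by rintro rfl; rw [dd_self2] at hc; exact lt_irrefl _ hc
  by_cases hcL : 0 < dd z p q c
  · have hcK : ¬ (0 < dd z b a c ∨ c = a) := fun h => by
      linarith [hs'f c ⟨hcL, h⟩ ncs']
    push Not at hcK
    obtain ⟨hBc, hca⟩ := hcK
    have hcb : c ≠ b := by rintro rfl; linarith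
    have hBc : dd z b a c < 0 := lt_of_le_of_ne hBc (gp _ _ _ nba hcb.symm hca.symm)
    have hBd : 0 < dd z b a d := by
      have e1 : dd z p s' d * dd z b a c < 0 := mul_neg_of_pos_of_neg hd hBc
      by_contra h
      have : 0 ≤ dd z p s' c * dd z b a d :=
        mul_nonneg_of_nonpos_of_nonpos hc.le (not_lt.1 h)
      linarith
    have nd := dd_ne_imp hBd.ne'
    have hCa : dd z c d a ≠ 0 := gp _ _ _ ncd hca nd.2.2.symm
    have hCb : dd z c d b ≠ 0 := gp _ _ _ ncd hcb nd.2.1.symm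
    rcases lt_or_gt_of_ne hCa with ha | ha <;> rcases lt_or_gt_of_ne hCb with hb | hb
    · -- both negative
      have hsc : 0 ≤ dd z p s c := by
        by_cases h : c = s
        · rw [h, dd_self2]
        · exact (hsf c hcL h).le
      have hcs'p : 0 < dd z p c s' := by rw [dd_swap']; linarith
      have hbc : 0 < dd z p b c := by
        have e := dd_plu z p b s c s'
        have e1 : 0 < dd z p b s * dd z p c s' := mul_pos hbs hcs'p
        have e2 : 0 ≤ dd z p b s' * dd z p s c := mul_nonneg hbs'.le hsc
        exact pos_of_mul_pos_left (by linarith : 0 < dd z p b c * dd z p s s') hss'.le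
      have hcap : 0 ≤ dd z p c a := by
        have e := dd_plu z p s c s' a
        have e1 : 0 ≤ dd z p s c * dd z p s' a := mul_nonneg hsc hs'a
        have e2 : 0 < dd z p s a * dd z p c s' := mul_pos hsa hcs'p
        exact (pos_of_mul_pos_right (by linarith : 0 < dd z p s s' * dd z p c a) hss'.le).le
      have id2 : dd z p b a * dd z c d c =
          dd z b a c * dd z c d p + dd z p c a * dd z c d b + dd z p b c * dd z c d a := by
        rw [dd_bary z p b a c d c, dd_rot z p c a, dd_rot z c a p]
      rw [dd_self1, mul_zero] at id2
      have e1 : dd z b a c * dd z c d p < 0 := mul_neg_of_neg_of_pos hBc (by linarith)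
      have e2 : dd z p c a * dd z c d b ≤ 0 := mul_nonpos_of_nonneg_of_nonpos hcap hb.le
      have e3 : dd z p b c * dd z c d a < 0 := mul_neg_of_pos_of_neg hbc ha
      linarith
    · exact nX ⟨mul_neg_of_pos_of_neg hb ha, mul_neg_of_neg_of_pos hBc hBd⟩
    · exact nX ⟨mul_neg_of_neg_of_pos hb ha, mul_neg_of_neg_of_pos hBc hBd⟩
    · have e2 : 0 ≤ dd z p s' a * dd z c d b := mul_nonneg hs'a hb.le
      have e3 : 0 < dd z p b s' * dd z c d a := mul_pos hbs' ha
      linarith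
  · push Not at hcL
    have hcs : c ≠ s := by rintro rfl; linarith
    have npc : p ≠ c := (dd_ne_imp hc.ne).2.1
    have hsc : dd z p s c < 0 := by
      rcases lt_or_gt_of_ne (gp p s c nps npc hcs.symm) with h | h
      · exact h
      · exfalso
        have e := dd_plu z p q s s' c
        have e1 : dd z p q s * dd z p s' c < 0 := mul_neg_of_pos_of_neg hs hc
        have e2 : 0 < dd z p q s' * dd z p s c := mul_pos hs'L h
        have e3 : dd z p q c * dd z p s s' ≤ 0 := mul_nonpos_of_nonpos_of_nonneg hcL hss'.le
        linarith
    have hsd : 0 < dd z p s d := by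
      have e := dd_plu z p s s' c d
      have e1 : 0 < dd z p s s' * dd z p c d := mul_pos hss' hcd
      have e2 : dd z p s c * dd z p s' d < 0 := mul_neg_of_neg_of_pos hsc hd
      by_contra h
      have : 0 ≤ dd z p s d * dd z p s' c :=
        mul_nonneg_of_nonpos_of_nonpos (not_lt.1 h) hc.le
      linarith
    have key : dd z p b a * (dd z p s d - dd z p s c) ≤
        dd z p c d * (dd z p s a - dd z p s b) := by
      by_contra h
      push Not at h
      have hlt2 : dd z p c d < dd z p s d - dd z p s c := by
        have e1 : dd z p b a * (dd z p s d - dd z p s c) <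
            (dd z p s a - dd z p s b) * (dd z p s d - dd z p s c) :=
          mul_lt_mul_of_pos_right hlt (by linarith)
        have : (dd z p s a - dd z p s b) * dd z p c d <
          (dd z p s a - dd z p s b) * (dd z p s d - dd z p s c) := by linarith
        exact lt_of_mul_lt_mul_left this (by linarith)
      have hm := hmin (c, d) ⟨hMcd, hsc, hsd, hcd, hlt2⟩
      simp only at hm
      rw [div_le_div_iff₀ (by linarith) (by linarith)] at hm
      linarith
    have id3 := dd_cr z p s b a c d
    rw [Cp, Cs] at id3
    have id3' : 0 ≤ dd z p s a * dd z c d b - dd z p s b * dd z c d a := by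
      rw [id3]; linarith
    have id4 := dd_cr z p s c d b a
    rw [Bp, Bs] at id4
    have id4' : dd z p s d * dd z b a c - dd z p s c * dd z b a d ≤ 0 := by
      rw [id4]; linarith
    have hCa : dd z c d a < 0 := by
      by_contra h
      push Not at h
      -- combine with [s,a]
      have f1 : dd z p s a * (dd z p s' a * dd z c d b) +
          dd z p s a * (dd z p b s' * dd z c d a) < 0 := by
        have : dd z p s a * (dd z p s' a * dd z c d b + dd z p b s' * dd z c d a) < 0 :=
          mul_neg_of_pos_of_neg hsa (by linarith)
        linarith
      have f2 : 0 ≤ dd z p s' a *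
          (dd z p s a * dd z c d b - dd z p s b * dd z c d a) := mul_nonneg hs'a id3'
      have f3 := dd_plu z p b s s' a
      have f4 : dd z p b s = - dd z p s b := dd_swap' z p b s
      have f5 : dd z p b s' * dd z p s a =
        dd z p b s * dd z p s' a + dd z p b a * dd z p s s' := by linarith
      have f6 : 0 ≤ dd z p b a * dd z p s s' * dd z c d a :=
        mul_nonneg (mul_pos hba hss').le h
      have f7 : dd z p s a * (dd z p b s' * dd z c d a) =
         - dd z p s b * dd z p s' a * dd z c d a + dd z p b a * dd z p s s' * dd z c d a := by
        rw [← f4]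
        linear_combination dd z c d a * f5
      linarith
    have hCb : 0 < dd z c d b := by
      have : 0 < dd z p s b * dd z c d a := mul_pos_of_neg_of_neg hsb hCa
      exact pos_of_mul_pos_right (by linarith : 0 < dd z p s a * dd z c d b) hsa.le
    have na := dd_ne_imp hCa.ne
    have nb := dd_ne_imp hCb.ne'
    refine nX ⟨mul_neg_of_pos_of_neg hCb hCa, ?_⟩
    rcases lt_or_gt_of_ne (gp b a c nba nb.2.1.symm na.2.1.symm) with h1 | h1 <;>
      rcases lt_or_gt_of_ne (gp b a d nba nb.2.2.symm na.2.2.symm) with h2 | h2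
    · exfalso
      have e1 : dd z p s' d * dd z b a c < 0 := mul_neg_of_pos_of_neg hd h1
      have e2 : 0 < dd z p s' c * dd z b a d := mul_pos_of_neg_of_neg hc h2
      linarith
    · exact mul_neg_of_neg_of_pos h1 h2
    · exact mul_neg_of_pos_of_neg h1 h2
    · exfalso
      have e1 : 0 < dd z p s d * dd z b a c := mul_pos hsd h1
      have e2 : dd z p s c * dd z b a d < 0 := mul_neg_of_neg_of_pos hsc h2
      linarith

theorem exists_tri [Finite ι] (gp : GP z) (mx : Mx z M) {p q : ι} (hpq : M p q)
    (hk : ∃ k, 0 < dd z p q k) : ∃ r, 0 < dd z p q r ∧ Tri z M p q r := by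
  obtain ⟨r, ⟨hMr, hr⟩, hrf⟩ := exists_first gp {k | M p k ∧ 0 < dd z p q k}
    (exists_nbr gp mx hk) (fun k hk => hk.2)
  simp only [Set.mem_ofPred_eq] at hrf
  have Qp : dd z q r p = dd z p q r := (dd_rot z p q r).symm
  have hQp : 0 < dd z q r p := by rw [Qp]; exact hr
  have hemp : ∀ k, ¬ (0 < dd z p q k ∧ 0 < dd z q r k ∧ 0 < dd z r p k) := by
    by_contra hne
    push Not at hne
    obtain ⟨s, ⟨hqs, hQs, hrs⟩, hmax⟩ := Set.exists_max_image
      {k | 0 < dd z p q k ∧ 0 < dd z q r k ∧ 0 < dd z r p k} (fun k => dd z q r k)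
      (Set.toFinite _) hne
    simp only [Set.mem_ofPred_eq] at hmax
    have hsr : 0 < dd z p s r := by rw [← dd_rot]; exact hrs
    have nps := (dd_ne_imp hqs.ne').2.1
    have npq := (dd_ne_imp hqs.ne').1
    by_cases hMs : M p s
    · have : s ≠ r := (dd_ne_imp hsr.ne').2.2
      have := hrf s ⟨hMs, hqs⟩ this
      rw [dd_swap'] at this
      linarith
    obtain ⟨c, d, hMcd, hc, hd, hcd, hclt⟩ := mx.block nps hMs
    have Cp : dd z c d p = dd z p c d := (dd_rot z p c d).symm
    have Cs : dd z c d s < 0 := by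
      rw [dd_sum z p c d s, dd_swap' z p d s]; linarith
    have hQps : dd z q r s < dd z q r p := by
      have e := dd_sum z s q r p
      have e1 := dd_rot z s q r
      have e2 := dd_rot z s r p
      have e3 := dd_rot z s p q
      linarith
    have id := dd_cr z p s c d q r
    have hor : dd z q r s < dd z q r c ∨ dd z q r s < dd z q r d := by
      by_contra h
      push Not at h
      have e1 := mul_le_mul_of_nonneg_left h.1 hd.le
      have e2 := mul_le_mul_of_nonpos_left h.2 hc.le
      have e3 := mul_lt_mul_of_pos_left hQps
        (by linarith : 0 < dd z p s d - dd z p s c - dd z p c d)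
      linarith
    have npc := (dd_ne_imp hc.ne).2.1
    have npd := (dd_ne_imp hd.ne').2.1
    have npr := (dd_ne_imp hr.ne').2.1
    rcases hor with hQ | hQ
    · have nqc : q ≠ c := by rintro rfl; rw [dd_self1] at hQ; linarith
      rcases lt_or_gt_of_ne (gp p q c npq npc nqc) with h | h
      · have hqd : 0 < dd z p q d := by
          have e := dd_plu z p q s c d
          have e1 : 0 < dd z p q s * dd z p c d := mul_pos hqs hcd
          have e2 : dd z p q c * dd z p s d < 0 := mul_neg_of_neg_of_pos h hd
          by_contra h'
          have : 0 ≤ dd z p q d * dd z p s c :=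
            mul_nonneg_of_nonpos_of_nonpos (not_lt.1 h') hc.le
          linarith
        have hCq : dd z c d q < 0 := by
          by_contra h'
          push Not at h'
          have b1 := dd_bary z p q s c d c
          rw [dd_self1, mul_zero] at b1
          have b2 := dd_bary z p q s q r c
          rw [dd_self1, mul_zero] at b2
          have e0 : dd z s p c = - dd z p s c := dd_swap z s p c
          have e1 : 0 ≤ dd z s p c * dd z c d q := mul_nonneg (by linarith) h'
          have e2 : 0 < dd z p q c * dd z c d s := mul_pos_of_neg_of_neg h Cs
          have e3 : dd z q s c < 0 := by
            by_contra h''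
            have : 0 ≤ dd z q s c * dd z c d p := mul_nonneg (not_lt.1 h'') (by linarith)
            linarith
          have e4 : dd z q s c * dd z q r p < 0 := mul_neg_of_neg_of_pos e3 hQp
          have e5 : dd z p q c * dd z q r s < 0 := mul_neg_of_neg_of_pos h hQs
          have e6 : 0 < dd z p q s * dd z q r c := mul_pos hqs (by linarith)
          linarith
        exact mx.nc _ _ _ _ hMcd hpq
          ⟨mul_neg_of_pos_of_neg (by linarith) hCq, mul_neg_of_neg_of_pos h hqd⟩
      · have hcr : 0 < dd z r p c := by
          rw [dd_rot]
          have e := dd_plu z p q c s r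
          have e0 : dd z p c s = - dd z p s c := dd_swap' z p c s
          have e1 : 0 < dd z p q c * dd z p s r := mul_pos h hsr
          have e2 : 0 < dd z p q r * dd z p c s := mul_pos hr (by linarith)
          exact pos_of_mul_pos_right (by linarith : 0 < dd z p q s * dd z p c r) hqs.le
        linarith [hmax c ⟨h, by linarith, hcr⟩]
    · have nrd : r ≠ d := by rintro rfl; rw [dd_self2] at hQ; linarith
      rcases lt_or_gt_of_ne (gp p r d npr npd nrd) with h | h
      · have hdr : 0 < dd z p d r := by rw [dd_swap']; linarith
        have hqd : 0 < dd z p q d := by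
          have e := dd_plu z p q s d r
          have e1 : 0 < dd z p q s * dd z p d r := mul_pos hqs hdr
          have e2 : 0 < dd z p q r * dd z p s d := mul_pos hr hd
          exact pos_of_mul_pos_left (by linarith : 0 < dd z p q d * dd z p s r) hsr.le
        have hrd : 0 < dd z r p d := by rw [dd_rot]; exact hdr
        linarith [hmax d ⟨hqd, by linarith, hrd⟩]
      · have hrc : dd z p r c < 0 := by
          have e := dd_plu z p s r c d
          have e1 : 0 < dd z p s r * dd z p c d := mul_pos hsr hcd
          have e2 : dd z p s c * dd z p r d < 0 := mul_neg_of_neg_of_pos hc h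
          by_contra h'
          have : 0 ≤ dd z p s d * dd z p r c := mul_nonneg hd.le (not_lt.1 h')
          linarith
        have hCr : dd z c d r < 0 := by
          by_contra h'
          push Not at h'
          have b1 := dd_bary z p s r c d d
          rw [dd_self2, mul_zero] at b1
          have b2 := dd_bary z p s r q r d
          rw [dd_self2 z q r, mul_zero] at b2
          have e0 : dd z r p d = - dd z p r d := dd_swap z r p d
          have e1 : 0 < dd z r p d * dd z c d s := mul_pos_of_neg_of_neg (by linarith) Cs
          have e2 : 0 ≤ dd z p s d * dd z c d r := mul_nonneg hd.le h'
          have e3 : dd z s r d < 0 := by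
            by_contra h''
            have : 0 ≤ dd z s r d * dd z c d p := mul_nonneg (not_lt.1 h'') (by linarith)
            linarith
          have e4 : dd z s r d * dd z q r p < 0 := mul_neg_of_neg_of_pos e3 hQp
          have e5 : dd z r p d * dd z q r s < 0 := mul_neg_of_neg_of_pos (by linarith) hQs
          have e6 : 0 < dd z p s r * dd z q r d := mul_pos hsr (by linarith)
          linarith
        exact mx.nc _ _ _ _ hMcd hMr
          ⟨mul_neg_of_pos_of_neg (by linarith) hCr, mul_neg_of_neg_of_pos hrc h⟩
  have hemp' : ∀ k, ¬ Ins z k p q r := by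
    rintro k (h | ⟨h1, h2, h3⟩)
    · exact hemp k h
    · have e := dd_sum z k p q r
      have e1 := dd_rot z k p q
      have e2 := dd_rot z k q r
      have e3 := dd_rot z k r p
      linarith
  refine ⟨r, hr, hpq, ?_, mx.symm _ _ hMr, hemp'⟩
  have nqr := (dd_ne_imp hr.ne').2.2
  have main : ∀ a b, M a b → 0 < dd z q r a → dd z q r b < 0 → ¬ XX z a b q r := by
    intro a b hM ha hb hX
    by_cases hap : a = p
    · subst hap
      have h1 := hX.1
      have e1 : dd z a b q = - dd z a q b := dd_swap' z a b q
      have e2 : dd z q r b = dd z a q r - dd z a b r - dd z a q b := by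
        rw [dd_sum z a q r b, dd_swap' z a r b, dd_swap' z a b q]; ring
      have e3 : 0 < dd z a q b := by
        by_contra h
        push Not at h
        have : 0 ≤ - dd z a q b * dd z a b r := mul_nonneg (by linarith) (by linarith)
        rw [e1] at h1
        linarith
      have e4 : 0 < dd z a b r := by
        by_contra h
        push Not at h
        rw [e1] at h1
        have : 0 ≤ - dd z a q b * dd z a b r :=
          mul_nonneg_of_nonpos_of_nonpos (by linarith) (by linarith)
        linarith
      have := hrf b ⟨hM, e3⟩ (dd_ne_imp e4.ne').2.2
      rw [dd_swap'] at this
      linarith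
    · rcases exit_core gp (mx.irr _ _ hM) hX hQp ha hap with h | h | h
      · exact hemp' a h
      · exact mx.nc _ _ _ _ hM hpq h
      · exact mx.nc _ _ _ _ hM hMr h
  apply mx.mx _ _ nqr
  intro a b hM hX
  rcases mul_neg_iff.1 hX.1 with ⟨h1, h2⟩ | ⟨h1, h2⟩
  · exact main a b hM h1 h2 hX.symm2
  · exact main b a (mx.symm _ _ hM) h2 h1 hX.symm2.symm1

end Geo2
section Geo3

variable {ι : Type} {z : ι → Pt} {M : ι → ι → Prop}

theorem flip_half_core (gp : GP z) (mx : Mx z M) {p q r s a b : ι}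
    (t1 : Tri z M p q r) (t2 : Tri z M p q s)
    (h1 : dd z p q r * dd z p q s < 0) (h2p : 0 < dd z r s p) (h2q : dd z r s q < 0)
    (hM : M a b) (hX : XX z a b r s) (ha : 0 < dd z r s p * dd z r s a) : a = p := by
  by_contra hap
  rcases exit_lem gp (mx.irr _ _ hM) hX ha hap with h | h | h
  · have ha' : 0 < dd z r s a := pos_of_mul_pos_right ha h2p.le
    have id0 : dd z p q s - dd z p q r = dd z r s p - dd z r s q := by
      simp only [dd, sideSign]; ring
    have hrs : dd z p q r < 0 ∧ 0 < dd z p q s := by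
      rcases mul_neg_iff.1 h1 with ⟨x, y⟩ | ⟨x, y⟩
      · linarith
      · exact ⟨x, y⟩
    obtain ⟨hr, hs⟩ := hrs
    rcases h with ⟨i1, i2, i3⟩ | ⟨i1, i2, i3⟩
    swap
    · linarith
    have haq : q ≠ a := by rintro rfl; linarith
    have npq := (dd_ne_imp hs.ne').1
    rcases lt_or_gt_of_ne (gp p q a npq (Ne.symm hap) haq) with h | h
    · apply t1.2.2.2 a
      right
      refine ⟨h, ?_, ?_⟩
      · have e := dd_plu z r q s a p
        have f1 : dd z r q s = - dd z r s q := dd_swap' z r q s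
        have f2 : dd z r a p = dd z p r a := (dd_rot z p r a).symm
        have f3 : dd z r q p = - dd z p q r := by
          rw [dd_swap' z r q p, dd_rot z r p q]
        have g1 : 0 < dd z r q s * dd z r a p := mul_pos (by linarith) (by linarith)
        have g2 : 0 < dd z r q p * dd z r s a := mul_pos (by linarith) (by linarith)
        have g3 : 0 < dd z r q a :=
          pos_of_mul_pos_left (by linarith : 0 < dd z r q a * dd z r s p) h2p.le
        rw [dd_swap]; linarith
      · rw [dd_swap]; linarith
    · apply t2.2.2.2 a
      left
      refine ⟨h, ?_, i3⟩
      have e := dd_plu z s p a r q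
      have f1 : dd z s r q = - dd z r s q := dd_swap z s r q
      have f2 : dd z s p q = dd z p q s := dd_rot z s p q
      have f3 : dd z s a r = dd z r s a := (dd_rot z r s a).symm
      have f4 : dd z s p r = dd z r s p := (dd_rot z r s p).symm
      have g1 : 0 < dd z s p a * dd z s r q := mul_pos (by linarith) (by linarith)
      have g2 : 0 < dd z s p q * dd z s a r := mul_pos (by linarith) (by linarith)
      have g3 : 0 < dd z s a q :=
        pos_of_mul_pos_right (by linarith : 0 < dd z s p r * dd z s a q) (by linarith)
      rw [dd_rot]; exact g3
  · exact mx.nc _ _ _ _ hM (mx.symm _ _ t1.2.2.1) h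
  · exact mx.nc _ _ _ _ hM (mx.symm _ _ t2.2.2.1) h

theorem flip_half (gp : GP z) (mx : Mx z M) {p q r s a b : ι}
    (t1 : Tri z M p q r) (t2 : Tri z M p q s)
    (h1 : dd z p q r * dd z p q s < 0) (h2 : dd z r s p * dd z r s q < 0)
    (hM : M a b) (hX : XX z a b r s) (ha : 0 < dd z r s p * dd z r s a) : a = p := by
  rcases mul_neg_iff.1 h2 with ⟨x, y⟩ | ⟨x, y⟩
  · exact flip_half_core gp mx t1 t2 h1 x y hM hX ha
  · have e1 := dd_swap z r s p
    have e2 := dd_swap z r s q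
    have e3 := dd_swap z r s a
    refine flip_half_core gp mx t2 t1 (by linarith) (by linarith) (by linarith) hM hX.symm3 ?_
    rw [e1, e3] at ha
    linarith

theorem flip_lem (gp : GP z) (mx : Mx z M) {p q r s a b : ι}
    (t1 : Tri z M p q r) (t2 : Tri z M p q s)
    (h1 : dd z p q r * dd z p q s < 0) (h2 : dd z r s p * dd z r s q < 0)
    (hM : M a b) (hX : XX z a b r s) : (a = p ∧ b = q) ∨ (a = q ∧ b = p) := by
  have h1' : dd z q p r * dd z q p s < 0 := by
    rw [dd_swap z q p r, dd_swap z q p s]; linarith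
  have h2' : dd z r s q * dd z r s p < 0 := by linarith
  have hM' := mx.symm _ _ hM
  have P1 : ∀ a b, M a b → XX z a b r s → 0 < dd z r s p * dd z r s a → a = p :=
    fun a b hM hX ha => flip_half gp mx t1 t2 h1 h2 hM hX ha
  have P2 : ∀ a b, M a b → XX z a b r s → 0 < dd z r s q * dd z r s a → a = q :=
    fun a b hM hX ha => flip_half gp mx (t1.swap mx) (t2.swap mx) h1' h2' hM hX ha
  rcases mul_neg_iff.1 h2 with ⟨x, y⟩ | ⟨x, y⟩ <;>
    rcases mul_neg_iff.1 hX.2 with ⟨u, v⟩ | ⟨u, v⟩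
  · exact Or.inl ⟨P1 a b hM hX (mul_pos x u), P2 b a hM' hX.symm1 (mul_pos_of_neg_of_neg y v)⟩
  · exact Or.inr ⟨P2 a b hM hX (mul_pos_of_neg_of_neg y u), P1 b a hM' hX.symm1 (mul_pos x v)⟩
  · exact Or.inr ⟨P2 a b hM hX (mul_pos y u), P1 b a hM' hX.symm1 (mul_pos_of_neg_of_neg x v)⟩
  · exact Or.inl ⟨P1 a b hM hX (mul_pos_of_neg_of_neg x u), P2 b a hM' hX.symm1 (mul_pos y v)⟩

theorem nonconvex (gp : GP z) {p q r s : ι}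
    (h1 : dd z p q r * dd z p q s < 0) (h2 : ¬ dd z r s p * dd z r s q < 0) :
    Ins z p q r s ∨ Ins z q p r s := by
  have hr : dd z p q r ≠ 0 := by intro h; rw [h] at h1; simp at h1
  have hs : dd z p q s ≠ 0 := by intro h; rw [h] at h1; simp at h1
  have nr := dd_ne_imp hr
  have ns := dd_ne_imp hs
  have nrs : r ≠ s := by rintro rfl; nlinarith
  have ep := gp r s p nrs nr.2.1.symm ns.2.1.symm
  have eq := gp r s q nrs nr.2.2.symm ns.2.2.symm
  have f1 : dd z q r p = dd z p q r := (dd_rot z p q r).symm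
  have f2 : dd z s q p = - dd z p q s := by rw [dd_swap', dd_rot z s p q]
  have f3 : dd z p r q = - dd z p q r := dd_swap' z p r q
  have f4 : dd z s p q = dd z p q s := dd_rot z s p q
  unfold Ins
  rw [f1, f2, f3, f4]
  rcases lt_or_gt_of_ne ep with a | a <;> rcases lt_or_gt_of_ne eq with b | b
  · rcases mul_neg_iff.1 h1 with ⟨x, y⟩ | ⟨x, y⟩
    · right; right; refine ⟨?_, ?_, ?_⟩ <;> linarith
    · left; right; refine ⟨?_, ?_, ?_⟩ <;> linarith
  · exact absurd (mul_neg_of_neg_of_pos a b) h2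
  · exact absurd (mul_neg_of_pos_of_neg a b) h2
  · rcases mul_neg_iff.1 h1 with ⟨x, y⟩ | ⟨x, y⟩
    · left; left; refine ⟨?_, ?_, ?_⟩ <;> linarith
    · right; left; refine ⟨?_, ?_, ?_⟩ <;> linarith

variable (z) in
def Hull (v u : ι) : Prop := v ≠ u ∧ ∀ k, k ≠ v → k ≠ u → 0 < dd z v u k

theorem Hull.not_ins {v u a b c : ι} (h : Hull z v u) : ¬ Ins z v a b c := by
  intro hi
  have key : dd z b c v * dd z v u a + dd z c a v * dd z v u b + dd z a b v * dd z v u c = 0 := by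
    simp only [dd, sideSign]; ring
  have nn : ∀ k, 0 ≤ dd z v u k := by
    intro k
    by_cases h1 : k = v
    · rw [h1, dd_self1]
    by_cases h2 : k = u
    · rw [h2, dd_self2]
    exact (h.2 k h1 h2).le
  have hab : dd z a b v ≠ 0 := by rcases hi with h | h <;> [exact h.1.ne'; exact h.1.ne]
  have n := dd_ne_imp hab
  have hpos : 0 < dd z v u a ∨ 0 < dd z v u b := by
    by_cases h1 : a = u
    · right; exact h.2 b n.2.2 (by rw [← h1]; exact n.1.symm)
    · left; exact h.2 a n.2.1 h1
  have na := nn a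
  have nb := nn b
  have nc := nn c
  rcases hi with ⟨i1, i2, i3⟩ | ⟨i1, i2, i3⟩
  · have e1 := mul_nonneg i2.le na
    have e2 := mul_nonneg i3.le nb
    have e3 := mul_nonneg i1.le nc
    rcases hpos with hp | hp
    · have := mul_pos i2 hp; linarith
    · have := mul_pos i3 hp; linarith
  · have e1 := mul_nonpos_of_nonpos_of_nonneg i2.le na
    have e2 := mul_nonpos_of_nonpos_of_nonneg i3.le nb
    have e3 := mul_nonpos_of_nonpos_of_nonneg i1.le nc
    rcases hpos with hp | hp
    · have := mul_neg_of_neg_of_pos i2 hp; linarith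
    · have := mul_neg_of_neg_of_pos i3 hp; linarith

theorem Hull.uniq {v u u' : ι} (h : Hull z v u) (h' : Hull z v u') : u = u' := by
  by_contra hne
  have e1 := h.2 u' h'.1.symm (Ne.symm hne)
  have e2 := h'.2 u h.1.symm hne
  rw [dd_swap'] at e2
  linarith

theorem cone_lem (gp : GP z) (mx : Mx z M) {p a b k : ι} (t : Tri z M p a b) (hk : M p k)
    (h0 : 0 < dd z p a b) (h1 : 0 < dd z p a k) (h2 : 0 < dd z p k b) : False := by
  have n0 := dd_ne_imp h0.ne'
  have n1 := dd_ne_imp h1.ne'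
  have n2 := dd_ne_imp h2.ne'
  rcases lt_or_gt_of_ne (gp a b k n0.2.2 n1.2.2 n2.2.2.symm) with h | h
  · apply mx.nc _ _ _ _ hk t.2.1
    refine ⟨?_, mul_neg_of_pos_of_neg (by rw [← dd_rot]; exact h0) h⟩
    rw [dd_swap' z p k a]
    exact mul_neg_of_neg_of_pos (by linarith) h2
  · apply t.2.2.2 k
    left
    refine ⟨h1, h, ?_⟩
    rw [dd_rot]; exact h2

theorem excl_core (gp : GP z) (mx : Mx z M) {p a b c d w : ι} (t1 : Tri z M p a b)
    (t2 : Tri z M p d w) (h1 : 0 < dd z p a b) (h2 : 0 < dd z p b c) (h3 : 0 < dd z p c a)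
    (g1 : 0 < dd z p c d) (g2 : 0 < dd z p d w) (g3 : 0 < dd z p w c) : a = d ∧ b = w := by
  have npa := (dd_ne_imp h1.ne').1
  have npb := (dd_ne_imp h1.ne').2.1
  have npd := (dd_ne_imp g2.ne').1
  have npw := (dd_ne_imp g2.ne').2.1
  have s1 := dd_swap' z p a c
  have s2 := dd_swap' z p d c
  have s3 := dd_swap' z p b d
  have s4 := dd_swap' z p w a
  have s5 := dd_swap' z p a d
  have s6 := dd_swap' z p b w
  constructor
  · by_contra hne
    rcases lt_or_gt_of_ne (gp p a d npa npd hne) with h | h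
    · -- a in cone (d,w)
      refine cone_lem gp mx t2 t1.1 g2 (by linarith : 0 < dd z p d a) ?_
      have e := dd_plu z p d w c a
      have e1 : 0 < dd z p d w * dd z p c a := mul_pos g2 h3
      have e2 : 0 < dd z p d a * dd z p w c := mul_pos (by linarith) g3
      by_contra hn
      have : 0 ≤ dd z p c d * dd z p a w * (-1) :=
        by nlinarith [mul_nonneg g1.le (by linarith : 0 ≤ - dd z p a w)]
      rw [s2, s4] at e
      linarith
    · refine cone_lem gp mx t1 (mx.symm _ _ t2.2.2.1 |> fun _ => t2.1) h1 h ?_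
      have e := dd_plu z p a b c d
      have e1 : 0 < dd z p a b * dd z p c d := mul_pos h1 g1
      have e2 : 0 < dd z p a d * dd z p b c := mul_pos h h2
      by_contra hn
      have : 0 ≤ dd z p c a * dd z p d b * (-1) :=
        by nlinarith [mul_nonneg h3.le (by linarith : 0 ≤ - dd z p d b)]
      rw [s1, s3] at e
      linarith
  · by_contra hne
    rcases lt_or_gt_of_ne (gp p b w npb npw hne) with h | h
    · -- w before b : w in cone (a,b)
      refine cone_lem gp mx t1 (mx.symm _ _ t2.2.2.1) h1 ?_ (by linarith : 0 < dd z p w b)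
      have e := dd_plu z p a b c w
      have c1 := dd_swap' z p c w
      have e1 : 0 < dd z p a b * dd z p w c := mul_pos h1 g3
      have e2 : 0 < dd z p c a * dd z p w b := mul_pos h3 (by linarith)
      rw [c1, s1, s6] at e
      exact pos_of_mul_pos_left (by linarith : 0 < dd z p a w * dd z p b c) h2.le
    · refine cone_lem gp mx t2 (mx.symm _ _ t1.2.2.1) g2 ?_ h
      have e := dd_plu z p d w c b
      have c1 := dd_swap' z p c b
      have c2 := dd_swap' z p w b
      have e1 : 0 < dd z p d w * dd z p b c := mul_pos g2 h2
      have e2 : 0 < dd z p c d * dd z p b w := mul_pos g1 h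
      rw [c1, s2, c2] at e
      exact pos_of_mul_pos_left (by linarith : 0 < dd z p d b * dd z p w c) g3.le

theorem excl (gp : GP z) (mx : Mx z M) {p a b c d w : ι} (t1 : Tri z M p a b)
    (t2 : Tri z M p d w) (hA : Ins z p a b c) (hC : Ins z p c d w) : d = a ∨ d = b := by
  have t1' : Tri z M p b a := (t1.rot.swap mx).rot.rot
  have t2' : Tri z M p w d := (t2.rot.swap mx).rot.rot
  unfold Ins at hA hC
  rw [← dd_rot z p a b, ← dd_rot z p b c, ← dd_rot z p c a] at hA
  rw [← dd_rot z p c d, ← dd_rot z p d w, ← dd_rot z p w c] at hC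
  have s1 := dd_swap' z p b a
  have s2 := dd_swap' z p a c
  have s3 := dd_swap' z p c b
  have s4 := dd_swap' z p d c
  have s5 := dd_swap' z p w d
  have s6 := dd_swap' z p c w
  rcases hA with ⟨h1, h2, h3⟩ | ⟨h1, h2, h3⟩ <;> rcases hC with ⟨g1, g2, g3⟩ | ⟨g1, g2, g3⟩
  · left
    exact (excl_core gp mx t1 t2 h1 h2 h3 g1 g2 g3).1.symm
  · right
    exact (excl_core gp mx (c := c) t1 t2' h1 h2 h3 (by linarith) (by linarith) (by linarith)).2.symm
  · right
    exact (excl_core gp mx (c := c) t1' t2 (by linarith) (by linarith) (by linarith) g1 g2 g3).1.symm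
  · left
    exact (excl_core gp mx (c := c) t1' t2' (by linarith) (by linarith) (by linarith)
      (by linarith) (by linarith) (by linarith)).2.symm

theorem exists_hull [Finite ι] (gp : GP z) {i0 i1 i2 : ι} (h01 : i0 ≠ i1) (h02 : i0 ≠ i2)
    (h12 : i1 ≠ i2) : ∃ v u, Hull z v u := by
  obtain ⟨p, -, hp⟩ := Set.exists_min_image (Set.univ : Set ι)
    (fun i => toLex (z i)) (Set.toFinite _) ⟨i0, trivial⟩
  have hp : ∀ k, (z p).1 < (z k).1 ∨ (z p).1 = (z k).1 ∧ (z p).2 ≤ (z k).2 := by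
    intro k
    have := hp k trivial
    rwa [Prod.Lex.toLex_le_toLex] at this
  have hne : {k | (z p).1 < (z k).1}.Nonempty := by
    by_contra hemp
    have hall : ∀ k, (z p).1 = (z k).1 := by
      intro k
      rcases hp k with h | h
      · exact absurd ⟨k, h⟩ hemp
      · exact h.1
    apply gp i0 i1 i2 h01 h02 h12
    simp only [dd, sideSign]
    rw [← hall i0, ← hall i1, ← hall i2]; ring
  obtain ⟨q, hq, hmin⟩ := Set.exists_min_image {k | (z p).1 < (z k).1}
    (fun k => ((z k).2 - (z p).2) / ((z k).1 - (z p).1)) (Set.toFinite _) hne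
  simp only [Set.mem_ofPred_eq] at hq hmin
  have npq : p ≠ q := by rintro rfl; exact lt_irrefl _ hq
  refine ⟨p, q, npq, fun k hkp hkq => ?_⟩
  refine lt_of_le_of_ne ?_ (gp p q k npq hkp.symm hkq.symm).symm
  simp only [dd, sideSign]
  rcases hp k with h | ⟨h1, h2⟩
  · have := hmin k h
    rw [div_le_div_iff₀ (by linarith) (by linarith)] at this
    linarith
  · rw [h1, sub_self, mul_zero, sub_zero]
    exact mul_nonneg (by linarith) (by linarith)

theorem exists_Mx [Finite ι] (C : ι → ι → Prop) (cs : ∀ i j, C i j → C j i)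
    (ci : ∀ i j, C i j → i ≠ j) (cn : ∀ i j k l, C i j → C k l → ¬ XX z i j k l) :
    ∃ M, Mx z M ∧ ∀ i j, C i j → M i j := by
  let Q : Set (ι × ι) → Prop := fun S => (∀ i j, (i, j) ∈ S → (j, i) ∈ S) ∧
    (∀ i j, (i, j) ∈ S → i ≠ j) ∧ ∀ i j k l, (i, j) ∈ S → (k, l) ∈ S → ¬ XX z i j k l
  obtain ⟨S, hCS, hS⟩ := Finite.exists_le_maximal (p := Q) (a := {x : ι × ι | C x.1 x.2})
    ⟨cs, ci, cn⟩
  obtain ⟨⟨q1, q2, q3⟩, hmax⟩ := hS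
  refine ⟨fun i j => (i, j) ∈ S, ⟨q1, q2, q3, ?_⟩, fun i j h => hCS h⟩
  intro i j hij hn
  have hself : ¬ XX z i j i j := by
    intro h; have := h.1; rw [dd_self1] at this; simp at this
  have hQ : Q (S ∪ {(i, j), (j, i)}) := by
    refine ⟨?_, ?_, ?_⟩
    · rintro a b (h | h)
      · exact Or.inl (q1 _ _ h)
      · right
        simp only [Set.mem_insert_iff, Set.mem_singleton_iff, Prod.mk.injEq] at h ⊢
        tauto
    · rintro a b (h | h)
      · exact q2 _ _ h
      · simp only [Set.mem_insert_iff, Set.mem_singleton_iff, Prod.mk.injEq] at h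
        rcases h with ⟨rfl, rfl⟩ | ⟨rfl, rfl⟩
        · exact hij
        · exact hij.symm
    · rintro a b c d (h | h) (h' | h') hX
      · exact q3 _ _ _ _ h h' hX
      · simp only [Set.mem_insert_iff, Set.mem_singleton_iff, Prod.mk.injEq] at h'
        rcases h' with ⟨rfl, rfl⟩ | ⟨rfl, rfl⟩
        · exact hn _ _ h hX.symm2
        · exact hn _ _ h hX.symm2.symm1
      · simp only [Set.mem_insert_iff, Set.mem_singleton_iff, Prod.mk.injEq] at h
        rcases h with ⟨rfl, rfl⟩ | ⟨rfl, rfl⟩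
        · exact hn _ _ h' hX
        · exact hn _ _ h' hX.symm1
      · simp only [Set.mem_insert_iff, Set.mem_singleton_iff, Prod.mk.injEq] at h h'
        rcases h with ⟨rfl, rfl⟩ | ⟨rfl, rfl⟩ <;> rcases h' with ⟨rfl, rfl⟩ | ⟨rfl, rfl⟩
        · exact hself hX
        · exact hself hX.symm3
        · exact hself hX.symm1
        · exact hself hX.symm1.symm3
  exact hmax hQ (Set.subset_union_left) (Or.inr (by simp))

end Geo3
section Comb

variable {t : ℕ} (z : ZMod t → Pt) (M : ZMod t → ZMod t → Prop)

def EN (i : ZMod t) : Prop := (∃ k, 0 < dd z i (i+1) k) ∧ (∃ k, dd z i (i+1) k < 0)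
def SS (i : ZMod t) : Prop := Tri z M (i-1) i (i+1)
def DN (i : ZMod t) : Prop :=
  SS z M i ∧ (∃ k, 0 < dd z (i-1) (i+1) k) ∧ (∃ k, dd z (i-1) (i+1) k < 0)
def SRel : ZMod t ⊕ ZMod t → ZMod t × Bool → Prop
  | .inl i, (v, true) => (SS z M i ∧ SS z M (i+1)) ∧ v = i ∧ Ins z i (i+1) (i-1) (i+2)
  | .inl i, (v, false) => (SS z M i ∧ SS z M (i+1)) ∧ v = i+1 ∧ Ins z (i+1) i (i-1) (i+2)
  | .inr i, (v, false) => v = i-1 ∧ ∃ w, Tri z M (i-1) (i+1) w ∧ Ins z (i-1) (i+1) i w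
  | .inr i, (v, true) => v = i+1 ∧ ∃ w, Tri z M (i-1) (i+1) w ∧ Ins z (i+1) (i-1) i w

theorem nat_ne (ht : 6 ≤ t) (k : ℕ) (h0 : 0 < k) (hk : k < 6) : (k : ZMod t) ≠ 0 := by
  intro h
  rw [ZMod.natCast_eq_zero_iff] at h
  exact absurd (Nat.le_of_dvd h0 h) (by omega)

variable {z M}

theorem SRel.uniq (ht : 6 ≤ t) (gp : GP z) (mx : Mx z M) {x y : ZMod t ⊕ ZMod t}
    {s : ZMod t × Bool} (hx : SRel z M x s) (hy : SRel z M y s) : x = y := by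
  have n3 := nat_ne ht 3 (by norm_num) (by norm_num)
  have n4 := nat_ne ht 4 (by norm_num) (by norm_num)
  push_cast at n3 n4
  have key : ∀ i j s, SRel z M (.inl i) s → SRel z M (.inr j) s → False := by
    rintro i j ⟨v, b⟩ h1 h2
    cases b
    · obtain ⟨⟨s1, s2⟩, e1, hA⟩ := h1
      obtain ⟨e2, w, tw, hC⟩ := h2
      have ej : j = i + 2 := by linear_combination e1 - e2
      subst ej
      have a1 : i + 2 - 1 = i + 1 := by ring
      have a2 : i + 2 + 1 = i + 3 := by ring
      rw [a1, a2] at tw hC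
      unfold SS at s1
      have := excl gp mx (p := i+1) (a := i) (b := i-1) (c := i+2) (d := i+3) (w := w)
        (s1.swap mx).rot.rot tw hA hC.swap
      rcases this with h | h
      · apply n3; linear_combination h
      · apply n4; linear_combination h
    · obtain ⟨⟨s1, s2⟩, e1, hA⟩ := h1
      obtain ⟨e2, w, tw, hC⟩ := h2
      have ej : j = i - 1 := by linear_combination e1 - e2
      subst ej
      have a1 : i - 1 - 1 = i - 2 := by ring
      have a2 : i - 1 + 1 = i := by ring
      rw [a1, a2] at tw hC
      have a3 : i + 1 - 1 = i := by ring
      have a4 : i + 1 + 1 = i + 2 := by ring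
      unfold SS at s2
      rw [a3, a4] at s2
      have := excl gp mx (p := i) (a := i+1) (b := i+2) (c := i-1) (d := i-2) (w := w)
        s2 (tw.swap mx) hA.swap.rot hC.swap
      rcases this with h | h
      · apply n3; linear_combination -h
      · apply n4; linear_combination -h
  rcases x with i | i <;> rcases y with j | j
  · rcases s with ⟨v, b⟩
    cases b
    · have e1 := hx.2.1; have e2 := hy.2.1
      congr 1; linear_combination e2 - e1
    · have e1 := hx.2.1; have e2 := hy.2.1
      congr 1; linear_combination e2 - e1
  · exact (key _ _ _ hx hy).elim
  · exact (key _ _ _ hy hx).elim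
  · rcases s with ⟨v, b⟩
    cases b
    · have e1 := hx.1; have e2 := hy.1
      congr 1; linear_combination e2 - e1
    · have e1 := hx.1; have e2 := hy.1
      congr 1; linear_combination e2 - e1

theorem SRel.not_hull {x : ZMod t ⊕ ZMod t} {s : ZMod t × Bool} (hx : SRel z M x s) (u : ZMod t) :
    ¬ Hull z s.1 u := by
  intro h
  rcases s with ⟨v, b⟩
  rcases x with i | i <;> cases b
  · obtain ⟨-, rfl, hi⟩ := hx; exact h.not_ins hi
  · obtain ⟨-, rfl, hi⟩ := hx; exact h.not_ins hi
  · obtain ⟨rfl, w, -, hi⟩ := hx; exact h.not_ins hi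
  · obtain ⟨rfl, w, -, hi⟩ := hx; exact h.not_ins hi

theorem opp_tri [Finite (ZMod t)] (gp : GP z) (mx : Mx z M) {p q : ZMod t} (hpq : M p q)
    (hk : ∃ k, dd z p q k < 0) : ∃ r, dd z p q r < 0 ∧ Tri z M p q r := by
  obtain ⟨k, hk⟩ := hk
  obtain ⟨r, h1, h2⟩ := exists_tri gp mx (mx.symm _ _ hpq) ⟨k, by rw [dd_swap]; linarith⟩
  exact ⟨r, by rw [dd_swap]; linarith, h2.swap mx⟩

theorem hull_of_not {p q : ZMod t} (gp : GP z) (hpq : p ≠ q)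
    (h : ¬ ((∃ k, 0 < dd z p q k) ∧ (∃ k, dd z p q k < 0))) : Hull z p q ∨ Hull z q p := by
  by_cases h1 : ∃ k, 0 < dd z p q k
  · left
    refine ⟨hpq, fun k h2 h3 => ?_⟩
    rcases lt_or_gt_of_ne (gp p q k hpq h2.symm h3.symm) with h4 | h4
    · exact absurd ⟨h1, k, h4⟩ h
    · exact h4
  · right
    refine ⟨hpq.symm, fun k h2 h3 => ?_⟩
    rw [dd_swap]
    rcases lt_or_gt_of_ne (gp p q k hpq h3.symm h2.symm) with h4 | h4
    · linarith
    · exact absurd ⟨k, h4⟩ h1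

theorem count_lem [Fintype (ZMod t)] (ht : 6 ≤ t) (gp : GP z) (mx : Mx z M)
    (hS : ∀ i, SS z M i ∨ SS z M (i+1)) (hE : ∀ i, EN z i → SS z M i ∧ SS z M (i+1))
    (hRE : ∀ i, EN z i → ∃ s, SRel z M (.inl i) s)
    (hRD : ∀ i, DN z M i → ∃ s, SRel z M (.inr i) s) : False := by
  classical
  have n1 := nat_ne ht 1 (by norm_num) (by norm_num)
  have n2 := nat_ne ht 2 (by norm_num) (by norm_num)
  have n3 := nat_ne ht 3 (by norm_num) (by norm_num)
  have n4 := nat_ne ht 4 (by norm_num) (by norm_num)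
  push_cast at n1 n2 n3 n4
  have hhull : ∃ v u, Hull z v u := exists_hull gp (i0 := 0) (i1 := 1) (i2 := 2)
    (fun h => n1 (by linear_combination -h)) (fun h => n2 (by linear_combination -h))
    (fun h => n1 (by linear_combination -h))
  set HF : Finset (ZMod t) := Finset.univ.filter (fun v => ∃ u, Hull z v u) with hHF
  set EF : Finset (ZMod t) := Finset.univ.filter (fun i => EN z i) with hEF
  set EC : Finset (ZMod t) := Finset.univ.filter (fun i => ¬ EN z i) with hEC
  set SF : Finset (ZMod t) := Finset.univ.filter (fun i => SS z M i) with hSF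
  set DF : Finset (ZMod t) := Finset.univ.filter (fun i => DN z M i) with hDF
  set DC : Finset (ZMod t) := Finset.univ.filter (fun i => SS z M i ∧ ¬ DN z M i) with hDC
  have c1 : EF.card + EC.card = Fintype.card (ZMod t) := by
    rw [hEF, hEC, Finset.card_filter_add_card_filter_not]; rfl
  have c2 : DF.card + DC.card = SF.card := by
    rw [← Finset.card_union_of_disjoint]
    · congr 1
      ext i
      simp only [hDF, hDC, hSF, Finset.mem_union, Finset.mem_filter, Finset.mem_univ, true_and]
      constructor
      · rintro (h | h)
        · exact h.1
        · exact h.1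
      · intro h
        by_cases hd : DN z M i
        · exact Or.inl hd
        · exact Or.inr ⟨h, hd⟩
    · rw [Finset.disjoint_left]
      intro i h1 h2
      simp only [hDF, hDC, Finset.mem_filter, Finset.mem_univ, true_and] at h1 h2
      exact h2.2 h1
  have c3 : 0 < HF.card := by
    obtain ⟨v, u, h⟩ := hhull
    exact Finset.card_pos.2 ⟨v, by simp only [hHF, Finset.mem_filter, Finset.mem_univ, true_and]; exact ⟨u, h⟩⟩
  -- slots
  have c4 : EF.card + DF.card ≤ 2 * (HFᶜ).card := by
    have hex : ∀ x ∈ EF.disjSum DF, ∃ s, SRel z M x s := by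
      intro x hx
      rw [Finset.mem_disjSum] at hx
      rcases hx with ⟨i, hi, rfl⟩ | ⟨i, hi, rfl⟩
      · exact hRE i (by simpa [hEF] using hi)
      · exact hRD i (by simpa [hDF] using hi)
    choose! f hf using hex
    have := Finset.card_le_card_of_injOn (s := EF.disjSum DF)
      (t := HFᶜ ×ˢ (Finset.univ : Finset Bool)) f ?_ ?_
    · rw [Finset.card_disjSum, Finset.card_product] at this
      simpa [mul_comm] using this
    · intro x hx
      have h := (hf x hx).not_hull
      simp only [Finset.coe_product, Set.mem_prod, Finset.mem_coe, Finset.mem_compl, hHF,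
        Finset.mem_filter, Finset.mem_univ, true_and, not_exists, and_true]
      exact h
    · intro x hx y hy hxy
      have h1 := hf x hx
      have h2 := hf y hy
      rw [← hxy] at h2
      exact h1.uniq ht gp mx h2
  have c4' := Finset.card_compl HF
  have c4'' := Finset.card_le_univ HF
  -- hull edges
  have c5 : EC.card + DC.card ≤ HF.card := by
    let A : ZMod t ⊕ ZMod t → ZMod t := fun x => Sum.elim (fun i => i) (fun i => i-1) x
    let B : ZMod t ⊕ ZMod t → ZMod t := fun x => Sum.elim (fun i => i+1) (fun i => i+1) x
    have hex : ∀ x ∈ EC.disjSum DC, ∃ s : ZMod t, ∃ u, Hull z s u ∧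
        ((s = A x ∧ u = B x) ∨ (s = B x ∧ u = A x)) := by
      intro x hx
      rw [Finset.mem_disjSum] at hx
      have : Hull z (A x) (B x) ∨ Hull z (B x) (A x) := by
        rcases hx with ⟨i, hi, rfl⟩ | ⟨i, hi, rfl⟩
        · have hi : ¬ EN z i := by simpa [hEC] using hi
          exact hull_of_not gp (fun (h : i = i + 1) => n1 (by linear_combination -h)) hi
        · have hi : SS z M i ∧ ¬ DN z M i := by simpa [hDC] using hi
          exact hull_of_not gp (fun (h : i - 1 = i + 1) => n2 (by linear_combination -h))
            (fun h => hi.2 ⟨hi.1, h⟩)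
      rcases this with h | h
      · exact ⟨_, _, h, Or.inl ⟨rfl, rfl⟩⟩
      · exact ⟨_, _, h, Or.inr ⟨rfl, rfl⟩⟩
    choose! f g hfg hAB using hex
    have := Finset.card_le_card_of_injOn (s := EC.disjSum DC) (t := HF) f ?_ ?_
    · rwa [Finset.card_disjSum] at this
    · intro x hx
      simp only [hHF, Finset.coe_filter, Finset.mem_univ, true_and, Set.mem_ofPred_eq]
      exact ⟨_, hfg x hx⟩
    · intro x hx y hy hxy
      have h1 := hfg x hx
      have h2 := hfg y hy
      rw [← hxy] at h2
      have h3 := h1.uniq h2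
      have e1 := hAB x hx
      have e2 := hAB y hy
      rw [← hxy, ← h3] at e2
      have e3 : (A x = A y ∧ B x = B y) ∨ (A x = B y ∧ B x = A y) := by
        rcases e1 with ⟨p1, p2⟩ | ⟨p1, p2⟩ <;> rcases e2 with ⟨q1, q2⟩ | ⟨q1, q2⟩
        · exact Or.inl ⟨p1 ▸ q1, p2 ▸ q2⟩
        · exact Or.inr ⟨p1 ▸ q1, p2 ▸ q2⟩
        · exact Or.inr ⟨p2 ▸ q2, p1 ▸ q1⟩
        · exact Or.inl ⟨p2 ▸ q2, p1 ▸ q1⟩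
      rcases x with i | i <;> rcases y with j | j <;>
        simp only [A, B, Sum.elim_inl, Sum.elim_inr] at e3 <;>
        rcases e3 with ⟨a, b⟩ | ⟨a, b⟩
      · rw [a]
      · exfalso; apply n2; linear_combination b - a
      · exfalso; apply n1; linear_combination a - b
      · exfalso; apply n3; linear_combination b - a
      · exfalso; apply n1; linear_combination b - a
      · exfalso; apply n3; linear_combination b - a
      · congr 1; linear_combination b
      · exfalso; apply n4; linear_combination b - a
  have c6 : Fintype.card (ZMod t) + EF.card ≤ 2 * SF.card := by
    have s1 : SF.card = ∑ i : ZMod t, (if SS z M i then 1 else 0) := by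
      rw [hSF, Finset.card_filter]
    have s2 : SF.card = ∑ i : ZMod t, (if SS z M (i+1) then 1 else 0) := by
      rw [s1]
      exact (Fintype.sum_equiv (Equiv.addRight (1 : ZMod t)) _ _ (fun i => rfl)).symm
    have s3 : Fintype.card (ZMod t) + EF.card = ∑ i : ZMod t, (1 + if EN z i then 1 else 0) := by
      rw [Finset.sum_add_distrib, hEF, Finset.card_filter]; simp
    rw [s3, two_mul]
    nth_rewrite 1 [s1]
    rw [s2, ← Finset.sum_add_distrib]
    apply Finset.sum_le_sum
    intro i _
    by_cases he : EN z i
    · have := hE i he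
      simp [he, this.1, this.2]
    · rcases hS i with h | h <;> simp [he, h]
  omega

end Comb
section Comb2

variable {t : ℕ} {z : ZMod t → Pt} {M : ZMod t → ZMod t → Prop}

theorem main_comb (ht : 6 ≤ t) (gp : GP z) (mx : Mx z M) (hC : ∀ i, M i (i+1))
    (c : ZMod t → ℕ) (hc : ∀ i, c i ≠ c (i+1))
    (hcross : ∀ i j, c i ≠ c j → j ≠ i+1 → i ≠ j+1 → ∃ k, XX z i j k (k+1)) :
    ∃ i, c i ≠ c (i+3) ∧ ∀ k, XX z i (i+3) k (k+1) → k = i+1 := by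
  have : NeZero t := ⟨by omega⟩
  by_contra hno
  push Not at hno
  have n1 := nat_ne ht 1 (by norm_num) (by norm_num)
  have n2 := nat_ne ht 2 (by norm_num) (by norm_num)
  have n3 := nat_ne ht 3 (by norm_num) (by norm_num)
  have n4 := nat_ne ht 4 (by norm_num) (by norm_num)
  push_cast at n1 n2 n3 n4
  have hmono : ∀ i j, M i j → c i ≠ c j → j = i+1 ∨ i = j+1 := by
    intro i j hM hcc
    by_contra h
    push Not at h
    obtain ⟨k, hk⟩ := hcross i j hcc h.1 h.2
    exact mx.nc _ _ _ _ hM (hC k) hk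
  have htri : ∀ i r, Tri z M i (i+1) r → (r = i-1 ∧ SS z M i) ∨ (r = i+2 ∧ SS z M (i+1)) := by
    intro i r h
    have h0 := h
    obtain ⟨-, m1, m2, -⟩ := h0
    by_cases hr : c r = c i
    · right
      have h1 : c (i+1) ≠ c r := by rw [hr]; exact (hc i).symm
      have : r = i + 2 := by
        rcases hmono _ _ m1 h1 with e | e
        · linear_combination e
        · exact absurd (by linear_combination -e) (mx.irr _ _ m2)
      subst this
      refine ⟨rfl, ?_⟩
      unfold SS
      have a3 : i + 1 - 1 = i := by ring
      have a4 : i + 1 + 1 = i + 2 := by ring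
      rw [a3, a4]; exact h
    · left
      have : r = i - 1 := by
        rcases hmono _ _ m2 hr with e | e
        · linear_combination -e
        · exact absurd (by linear_combination -e) (mx.irr _ _ m1)
      subst this
      exact ⟨rfl, h.rot.rot⟩
  have hS : ∀ i, SS z M i ∨ SS z M (i+1) := by
    intro i
    have hd : dd z i (i+1) (i+2) ≠ 0 := gp _ _ _ (fun h => n1 (by linear_combination -h))
      (fun h => n2 (by linear_combination -h)) (fun h => n1 (by linear_combination -h))
    have : ∃ r, Tri z M i (i+1) r := by
      rcases lt_or_gt_of_ne hd with h | h
      · obtain ⟨r, -, hr⟩ := opp_tri gp mx (hC i) ⟨_, h⟩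
        exact ⟨r, hr⟩
      · obtain ⟨r, -, hr⟩ := exists_tri gp mx (hC i) ⟨_, h⟩
        exact ⟨r, hr⟩
    obtain ⟨r, hr⟩ := this
    rcases htri i r hr with h | h
    · exact Or.inl h.2
    · exact Or.inr h.2
  have hE' : ∀ i, EN z i → (SS z M i ∧ SS z M (i+1)) ∧
      dd z i (i+1) (i-1) * dd z i (i+1) (i+2) < 0 := by
    rintro i ⟨hp, hn⟩
    obtain ⟨r, r1, r2⟩ := exists_tri gp mx (hC i) hp
    obtain ⟨s, s1, s2⟩ := opp_tri gp mx (hC i) hn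
    rcases htri i r r2 with ⟨rfl, h⟩ | ⟨rfl, h⟩ <;> rcases htri i s s2 with ⟨rfl, h'⟩ | ⟨rfl, h'⟩
    · linarith
    · exact ⟨⟨h, h'⟩, mul_neg_of_pos_of_neg r1 s1⟩
    · exact ⟨⟨h', h⟩, mul_neg_of_neg_of_pos s1 r1⟩
    · linarith
  have hcS : ∀ i, SS z M i → c (i-1) = c (i+1) := by
    intro i h
    by_contra hcc
    rcases hmono _ _ (mx.symm _ _ h.2.2.1) hcc with e | e
    · exact n1 (by linear_combination e)
    · exact n3 (by linear_combination -e)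
  apply count_lem ht gp mx hS (fun i h => (hE' i h).1)
  · intro i hi
    obtain ⟨⟨s1, s2⟩, hopp⟩ := hE' i hi
    have t1 : Tri z M i (i+1) (i-1) := s1.rot
    have t2 : Tri z M i (i+1) (i+2) := by
      have := s2
      unfold SS at this
      have a3 : i + 1 - 1 = i := by ring
      have a4 : i + 1 + 1 = i + 2 := by ring
      rwa [a3, a4] at this
    by_cases hcv : dd z (i-1) (i+2) i * dd z (i-1) (i+2) (i+1) < 0
    · exfalso
      have e3 : i - 1 + 3 = i + 2 := by ring
      have hne : c (i-1) ≠ c (i-1+3) := by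
        rw [e3, hcS i s1]
        have := hc (i+1)
        rwa [show i + 1 + 1 = i + 2 by ring] at this
      obtain ⟨k, hk, hk'⟩ := hno (i-1) hne
      rw [e3] at hk
      rcases flip_lem gp mx t1 t2 hopp hcv (hC k) hk.symm2 with ⟨a, b⟩ | ⟨a, b⟩
      · exact hk' (by rw [a]; ring)
      · exact n2 (by linear_combination b - a)
    · rcases nonconvex gp hopp hcv with h | h
      · exact ⟨(i, true), ⟨s1, s2⟩, rfl, h⟩
      · exact ⟨(i+1, false), ⟨s1, s2⟩, rfl, h⟩
  · rintro i ⟨s1, hp, hn⟩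
    have t1 : Tri z M (i-1) (i+1) i := s1.rot.rot.swap mx
    have mm : M (i-1) (i+1) := t1.1
    have hd : dd z (i-1) (i+1) i ≠ 0 := gp _ _ _ (fun h => n2 (by linear_combination -h))
      (fun h => n1 (by linear_combination -h)) (fun h => n1 (by linear_combination h))
    have : ∃ w, dd z (i-1) (i+1) i * dd z (i-1) (i+1) w < 0 ∧ Tri z M (i-1) (i+1) w := by
      rcases lt_or_gt_of_ne hd with h | h
      · obtain ⟨r, hr0, hr⟩ := exists_tri gp mx mm hp
        exact ⟨r, mul_neg_of_neg_of_pos h hr0, hr⟩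
      · obtain ⟨r, hr0, hr⟩ := opp_tri gp mx mm hn
        exact ⟨r, mul_neg_of_pos_of_neg h hr0, hr⟩
    obtain ⟨w, hopp, t2⟩ := this
    have hwi : w ≠ i := by
      rintro rfl
      nlinarith [mul_self_nonneg (dd z (w-1) (w+1) w)]
    have hw1 : w ≠ i + 1 := fun h => mx.irr _ _ t2.2.1 h.symm
    have hw2 : w ≠ i - 1 := fun h => mx.irr _ _ t2.2.2.1 h
    have hcw : c w = c (i+1) := by
      by_contra hcc
      have hcc2 : c w ≠ c (i-1) := by rw [hcS i s1]; exact hcc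
      rcases hmono _ _ t2.2.1 (Ne.symm hcc) with e | e
      · rcases hmono _ _ t2.2.2.1 hcc2 with e' | e'
        · exact n4 (by linear_combination - e - e')
        · exact n2 (by linear_combination e' - e)
      · exact hwi (by linear_combination -e)
    obtain ⟨k, hk⟩ := hcross i w (by rw [hcw]; exact hc i) hw1
      (fun h => hw2 (by linear_combination -h))
    by_cases hcv : dd z i w (i-1) * dd z i w (i+1) < 0
    · exfalso
      rcases flip_lem gp mx t1 t2 hopp hcv (hC k) hk.symm2 with ⟨a, b⟩ | ⟨a, b⟩
      · exact n1 (by linear_combination a - b)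
      · exact n3 (by linear_combination b - a)
    · rcases nonconvex gp hopp hcv with h | h
      · exact ⟨(i-1, false), rfl, w, t2, h⟩
      · exact ⟨(i+1, true), rfl, w, t2, h⟩

end Comb2
section Conv

theorem seg_sw {a b x : Pt} (h : x ∈ segment ℝ a b) : x ∈ segment ℝ b a := by
  rwa [segment_symm]

theorem ss_comb (p q a b : Pt) (u v : ℝ) (h : u + v = 1) :
    sideSign p q (u • a + v • b) = u * sideSign p q a + v * sideSign p q b := by
  have : u = 1 - v := by linarith
  subst this
  simp only [sideSign, Prod.fst_add, Prod.snd_add, Prod.smul_fst, Prod.smul_snd, smul_eq_mul]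
  ring

theorem ss_self (a b : Pt) : sideSign a b a = 0 := by simp only [sideSign]; ring
theorem ss_self' (a b : Pt) : sideSign a b b = 0 := by simp only [sideSign]; ring

theorem ss_seg {a b x : Pt} (h : x ∈ segment ℝ a b) : sideSign a b x = 0 := by
  obtain ⟨u, v, -, -, huv, rfl⟩ := h
  rw [ss_comb _ _ _ _ _ _ huv, ss_self, ss_self']; ring

theorem ss_meet1 {a b p q x : Pt} (h1 : sideSign a b p ≠ 0) (h2 : sideSign a b q ≠ 0)
    (hx : x ∈ segment ℝ a b) (hx' : x ∈ segment ℝ p q) :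
    sideSign a b p * sideSign a b q < 0 := by
  have h0 := ss_seg hx
  obtain ⟨u, v, hu, hv, huv, rfl⟩ := hx'
  rw [ss_comb _ _ _ _ _ _ huv] at h0
  by_contra hcon
  have hpos : 0 < sideSign a b p * sideSign a b q :=
    lt_of_le_of_ne (not_lt.1 hcon) (mul_ne_zero h1 h2).symm
  have e : u * (sideSign a b p * sideSign a b p) + v * (sideSign a b p * sideSign a b q) = 0 := by
    linear_combination sideSign a b p * h0
  have sp : 0 < sideSign a b p * sideSign a b p := mul_self_pos.2 h1
  rcases hu.lt_or_eq with h | h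
  · nlinarith [mul_pos h sp, mul_nonneg hv hpos.le]
  · have : v = 1 := by linarith
    subst this
    rw [← h] at e
    linarith

theorem ss_share {a b q x : Pt} (h : sideSign a b q ≠ 0)
    (hx : x ∈ segment ℝ a b) (hx' : x ∈ segment ℝ a q) : x = a := by
  have h0 := ss_seg hx
  obtain ⟨u, v, hu, hv, huv, rfl⟩ := hx'
  rw [ss_comb _ _ _ _ _ _ huv, ss_self, mul_zero, zero_add] at h0
  have hv0 : v = 0 := by
    rcases mul_eq_zero.1 h0 with h' | h'
    · exact h'
    · exact absurd h' h
  subst hv0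
  have : u = 1 := by linarith
  subst this
  simp

theorem ss_cross {a b p q : Pt} (h1 : sideSign a b p * sideSign a b q < 0)
    (h2 : sideSign p q a * sideSign p q b < 0) :
    (segment ℝ a b ∩ segment ℝ p q).Nonempty := by
  have aux : ∀ α β : ℝ, α * β < 0 → β - α ≠ 0 ∧ 0 ≤ β / (β - α) ∧ 0 ≤ - α / (β - α) := by
    intro α β h
    rcases mul_neg_iff.1 h with ⟨x, y⟩ | ⟨x, y⟩
    · refine ⟨by linarith, ?_, ?_⟩
      · exact div_nonneg_of_nonpos y.le (by linarith)
      · exact div_nonneg_of_nonpos (by linarith) (by linarith)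
    · refine ⟨by linarith, ?_, ?_⟩
      · exact div_nonneg y.le (by linarith)
      · exact div_nonneg (by linarith) (by linarith)
  obtain ⟨d1, p1, q1⟩ := aux _ _ h1
  obtain ⟨d2, p2, q2⟩ := aux _ _ h2
  refine ⟨_, ⟨_, _, p2, q2, ?_, rfl⟩, ⟨_, _, p1, q1, ?_, ?_⟩⟩
  · field_simp; ring
  · field_simp; ring
  · have e : sideSign p q b - sideSign p q a = - (sideSign a b q - sideSign a b p) := by
      simp only [sideSign]; ring
    rw [e]
    have d1' : -(sideSign a b q - sideSign a b p) ≠ 0 := neg_ne_zero.2 d1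
    ext
    · simp only [Prod.fst_add, Prod.smul_fst, smul_eq_mul]
      field_simp
      simp only [sideSign]; ring
    · simp only [Prod.snd_add, Prod.smul_snd, smul_eq_mul]
      field_simp
      simp only [sideSign]; ring

theorem ss_collinear {a b c : Pt} (hab : a ≠ b) (h : sideSign a b c = 0) :
    Collinear ℝ ({a, b, c} : Set Pt) := by
  rw [collinear_iff_of_mem (p₀ := a) (by simp)]
  refine ⟨b - a, ?_⟩
  have hc : ∃ r : ℝ, c = r • (b - a) +ᵥ a := by
    simp only [sideSign] at h
    by_cases h1 : b.1 - a.1 = 0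
    · have h2 : b.2 - a.2 ≠ 0 := by
        intro h2
        exact hab (Prod.ext (by linarith) (by linarith))
      refine ⟨(c.2 - a.2) / (b.2 - a.2), ?_⟩
      ext
      · simp only [vadd_eq_add, Prod.fst_add, Prod.smul_fst, Prod.fst_sub, smul_eq_mul]
        field_simp
        linear_combination -h
      · simp only [vadd_eq_add, Prod.snd_add, Prod.smul_snd, Prod.snd_sub, smul_eq_mul]
        field_simp
        ring
    · refine ⟨(c.1 - a.1) / (b.1 - a.1), ?_⟩
      ext
      · simp only [vadd_eq_add, Prod.fst_add, Prod.smul_fst, Prod.fst_sub, smul_eq_mul]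
        field_simp
        ring
      · simp only [vadd_eq_add, Prod.snd_add, Prod.smul_snd, Prod.snd_sub, smul_eq_mul]
        field_simp
        linear_combination h
  intro p hp
  simp only [Set.mem_insert_iff, Set.mem_singleton_iff] at hp
  rcases hp with rfl | rfl | rfl
  · exact ⟨0, by simp⟩
  · exact ⟨1, by simp⟩
  · exact hc

variable {ι : Type} {z : ι → Pt}

theorem XX_of_meet (gp : GP z) {i j k l : ι} (hij : i ≠ j) (hkl : k ≠ l) (hik : i ≠ k)
    (hil : i ≠ l) (hjk : j ≠ k) (hjl : j ≠ l) {x : Pt} (hx : x ∈ segment ℝ (z i) (z j))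
    (hx' : x ∈ segment ℝ (z k) (z l)) : XX z i j k l :=
  ⟨ss_meet1 (gp i j k hij hik hjk) (gp i j l hij hil hjl) hx hx',
   ss_meet1 (gp k l i hkl hik.symm hil.symm) (gp k l j hkl hjk.symm hjl.symm) hx' hx⟩

theorem share_pt (gp : GP z) {i j l : ι} (hij : i ≠ j) (hil : i ≠ l) (hjl : j ≠ l)
    {x : Pt} (hx : x ∈ segment ℝ (z i) (z j))
    (hx' : x ∈ segment ℝ (z i) (z l)) : x = z i :=
  ss_share (gp i j l hij hil hjl) hx hx'

theorem XX_of_crosses (gp : GP z) {i j k l : ι} (hij : i ≠ j) (hkl : k ≠ l)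
    (h1 : ¬ (i = k ∧ j = l)) (h2 : ¬ (i = l ∧ j = k))
    (h : Crosses (z i) (z j) (z k) (z l)) : XX z i j k l := by
  obtain ⟨x, hx, hx', hn⟩ := h
  by_cases hik : i = k
  · subst hik
    have := share_pt gp hij hkl (fun h => h1 ⟨rfl, h⟩) hx hx'
    subst this
    exact absurd ⟨by simp, by simp⟩ hn
  by_cases hil : i = l
  · subst hil
    have := share_pt gp hij (Ne.symm hkl) (fun h => h2 ⟨rfl, h⟩) hx (seg_sw hx')
    subst this
    exact absurd ⟨by simp, by simp⟩ hn
  by_cases hjk : j = k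
  · subst hjk
    have := share_pt gp hij.symm hkl hil (seg_sw hx) hx'
    subst this
    exact absurd ⟨by simp, by simp⟩ hn
  by_cases hjl : j = l
  · subst hjl
    have := share_pt gp hij.symm hkl.symm hik (seg_sw hx) (seg_sw hx')
    subst this
    exact absurd ⟨by simp, by simp⟩ hn
  exact XX_of_meet gp hij hkl hik hil hjk hjl hx hx'

theorem XX.ne {i j k l : ι} (h : XX z i j k l) : i ≠ k ∧ i ≠ l ∧ j ≠ k ∧ j ≠ l := by
  have h1 : dd z i j k ≠ 0 := by intro e; have := h.1; rw [e] at this; simp at this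
  have h2 : dd z i j l ≠ 0 := by intro e; have := h.1; rw [e] at this; simp at this
  exact ⟨(dd_ne_imp h1).2.1, (dd_ne_imp h2).2.1, (dd_ne_imp h1).2.2, (dd_ne_imp h2).2.2⟩

end Conv
/-- if every differently-colored non-edge chord of a plane Hamiltonian cycle `γ`
of length `t ≥ 6` crosses some edge of `γ`, then there are four cyclically consecutive points
`γ i, γ (i+1), γ (i+2), γ (i+3)` with `φ (γ i) ≠ φ (γ (i+3))` such that deleting `γ (i+1)` and
`γ (i+2)` and joining `γ i` to `γ (i+3)` yields a plane cycle of length `t - 2`. -/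
theorem stmt_7 (P : Set Pt) (φ : Pt → ℕ) (hfin : P.Finite) (hgp : GenPos P)
    (t : ℕ) (ht : 6 ≤ t) (γ : ZMod t → Pt)
    (hcyc : IsPlaneCycle φ t γ) (hham : Set.range γ = P)
    (hcross : ∀ p ∈ P, ∀ q ∈ P, φ p ≠ φ q → ¬ IsEdgeOf t γ p q →
      ∃ i : ZMod t, Crosses p q (γ i) (γ (i + 1))) :
    ∃ i : ZMod t, φ (γ i) ≠ φ (γ (i + 3)) ∧
      IsPlaneCycle φ (t - 2) (fun j : ZMod (t - 2) => γ (i + 3 + (j.val : ZMod t))) := by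
  have : NeZero t := ⟨by omega⟩
  have n1 := nat_ne ht 1 (by norm_num) (by norm_num)
  have n2 := nat_ne ht 2 (by norm_num) (by norm_num)
  have n3 := nat_ne ht 3 (by norm_num) (by norm_num)
  have n4 := nat_ne ht 4 (by norm_num) (by norm_num)
  push_cast at n1 n2 n3 n4
  obtain ⟨-, hinj, hcol, hseg⟩ := hcyc
  have hP : ∀ i, γ i ∈ P := fun i => hham ▸ Set.mem_range_self i
  have gp : GP γ := fun i j k hij hik hjk h =>
    hgp _ (hP i) _ (hP j) _ (hP k) (hinj.ne hij) (hinj.ne hik) (hinj.ne hjk)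
      (ss_collinear (hinj.ne hij) h)
  have hs1 : ∀ i : ZMod t, i ≠ i + 1 := fun i h => n1 (by linear_combination -h)
  have hnx : ∀ i k, ¬ XX γ i (i+1) k (k+1) := by
    intro i k h
    have hne := h.ne
    have := (hseg i k hne.1).2 (Ne.symm hne.2.2.1) hne.2.1
    exact (ss_cross h.1 h.2).ne_empty this
  obtain ⟨M, mx, hM⟩ := exists_Mx (z := γ) (fun i j => j = i + 1 ∨ i = j + 1)
    (fun i j h => h.symm)
    (by rintro i j (rfl | rfl)
        · exact hs1 _
        · exact (hs1 _).symm)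
    (by rintro i j k l (rfl | rfl) (rfl | rfl) h
        · exact hnx _ _ h
        · exact hnx _ _ h.symm3
        · exact hnx _ _ h.symm1
        · exact hnx _ _ h.symm1.symm3)
  obtain ⟨i, hi, hX⟩ := main_comb ht gp mx (fun i => hM _ _ (Or.inl rfl)) (fun i => φ (γ i)) hcol
    (by
      intro i j hc h1 h2
      have hne : ¬ IsEdgeOf t γ (γ i) (γ j) := by
        rintro ⟨k, ⟨a, b⟩ | ⟨a, b⟩⟩
        · exact h1 (by rw [hinj b, hinj a])
        · exact h2 (by rw [hinj b, hinj a])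
      obtain ⟨k, hk⟩ := hcross _ (hP i) _ (hP j) hc hne
      refine ⟨k, XX_of_crosses gp ?_ (hs1 k) ?_ ?_ hk⟩
      · rintro rfl; exact hc rfl
      · rintro ⟨rfl, h⟩; exact h1 h
      · rintro ⟨h, rfl⟩; exact h2 h)
  refine ⟨i, hi, ?_⟩
  obtain ⟨n, rfl⟩ : ∃ n, t = n + 2 := ⟨t - 2, by omega⟩
  rw [show n + 2 - 2 = n by omega]
  have hn0 : NeZero n := ⟨by omega⟩
  have hn1 : Fact (1 < n) := ⟨by omega⟩
  have hcast : ((n : ℕ) : ZMod (n+2)) = -2 := by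
    have := ZMod.natCast_self (n+2)
    push_cast at this
    linear_combination this
  obtain ⟨f, hf⟩ : ∃ f : ZMod n → ZMod (n+2), f = fun j => i + 3 + (j.val : ZMod (n+2)) := ⟨_, rfl⟩
  have hfe : ∀ j, f j = i + 3 + (j.val : ZMod (n+2)) := fun j => by rw [hf]
  have hfinj : Function.Injective f := by
    intro a b h
    rw [hfe, hfe] at h
    have h' : (a.val : ZMod (n+2)) = b.val := by linear_combination h
    rw [ZMod.natCast_eq_natCast_iff', Nat.mod_eq_of_lt (by have := a.val_lt; omega),
      Nat.mod_eq_of_lt (by have := b.val_lt; omega)] at h'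
    exact ZMod.val_injective n h'
  have hstep : ∀ j, f (j+1) = f j + 1 ∨ (f j = i ∧ f (j+1) = i + 3) := by
    intro j
    have hv : (j+1).val = (j.val + 1) % n := by rw [ZMod.val_add, ZMod.val_one]
    have hlt := j.val_lt
    by_cases h : j.val + 1 = n
    · right
      have h' : ((j.val + 1 : ℕ) : ZMod (n+2)) = -2 := by rw [h, hcast]
      push_cast at h'
      rw [h, Nat.mod_self] at hv
      rw [hfe, hfe, hv]
      constructor
      · linear_combination h'
      · simp
    · left
      rw [Nat.mod_eq_of_lt (by omega)] at hv
      rw [hfe, hfe, hv]; push_cast; ring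
  have hf1 : ∀ j, f j ≠ i + 1 := by
    intro j h
    rw [hfe] at h
    have h' : ((j.val + 2 : ℕ) : ZMod (n+2)) = 0 := by push_cast; linear_combination h
    rw [ZMod.natCast_eq_zero_iff] at h'
    have := Nat.le_of_dvd (by omega) h'
    have := j.val_lt
    omega
  have hf2 : ∀ j, f j ≠ i + 2 := by
    intro j h
    rw [hfe] at h
    have h' : ((j.val + 1 : ℕ) : ZMod (n+2)) = 0 := by push_cast; linear_combination h
    rw [ZMod.natCast_eq_zero_iff] at h'
    have := Nat.le_of_dvd (by omega) h'
    have := j.val_lt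
    omega
  have hsucc : ∀ a b, f a = f b + 1 → a = b + 1 := by
    intro a b h
    rcases hstep b with e | ⟨e, -⟩
    · exact hfinj (h.trans e.symm)
    · rw [e] at h; exact absurd h (hf1 a)
  have hi3 : i ≠ i + 3 := fun h => n3 (by linear_combination -h)
  have hdis : ∀ m, m ≠ i → m + 1 ≠ i → m ≠ i + 1 → m ≠ i + 2 → m ≠ i + 3 →
      segment ℝ (γ i) (γ (i+3)) ∩ segment ℝ (γ m) (γ (m+1)) = ∅ := by
    intro m a1 a2 a3 a4 a5
    rw [Set.eq_empty_iff_forall_notMem]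
    rintro x ⟨hx, hx'⟩
    exact a3 (hX m (XX_of_meet gp hi3 (hs1 m) a1.symm a2.symm a5.symm
      (fun h => a4 (by linear_combination -h)) hx hx'))
  have hgoal : (fun j : ZMod n => γ (i + 3 + (j.val : ZMod (n+2)))) = fun j => γ (f j) := by
    rw [hf]
  rw [hgoal]
  refine ⟨by omega, hinj.comp hfinj, ?_, ?_⟩
  · intro j
    show φ (γ (f j)) ≠ φ (γ (f (j+1)))
    rcases hstep j with e | ⟨e1, e2⟩
    · rw [e]; exact hcol _
    · rw [e1, e2]; exact hi
  · intro a b hab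
    have hfab : f a ≠ f b := hfinj.ne hab
    refine ⟨fun h => ?_, fun h1 h2 => ?_⟩
    · show segment ℝ (γ (f a)) (γ (f (a+1))) ∩ segment ℝ (γ (f b)) (γ (f (b+1))) = {γ (f (a+1))}
      subst h
      rcases hstep a with e | ⟨e1, e2⟩
      · rcases hstep (a+1) with e' | ⟨e1', e2'⟩
        · rw [e', e]
          exact (hseg (f a) (f a + 1) (hs1 _)).1 rfl
        · rw [e2', e1']
          have ea : f a = i - 1 := by linear_combination e1' - e
          rw [ea]
          apply Set.eq_singleton_iff_unique_mem.2
          refine ⟨⟨right_mem_segment ℝ _ _, left_mem_segment ℝ _ _⟩, ?_⟩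
          rintro x ⟨hx, hx'⟩
          refine share_pt gp ?_ hi3 ?_ (seg_sw hx) hx'
          · intro h; exact n1 (by linear_combination h)
          · intro h; exact n4 (by linear_combination -h)
      · rw [e1, e2]
        have e' : f (a+1+1) = i + 4 := by
          rcases hstep (a+1) with e' | ⟨e1', e2'⟩
          · rw [e', e2]; ring
          · exact absurd (e1'.symm.trans e2) hi3
        rw [e']
        apply Set.eq_singleton_iff_unique_mem.2
        refine ⟨⟨right_mem_segment ℝ _ _, left_mem_segment ℝ _ _⟩, ?_⟩
        rintro x ⟨hx, hx'⟩
        refine share_pt gp hi3.symm ?_ ?_ (seg_sw hx) hx'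
        · intro h; exact n1 (by linear_combination -h)
        · intro h; exact n4 (by linear_combination -h)
    · show segment ℝ (γ (f a)) (γ (f (a+1))) ∩ segment ℝ (γ (f b)) (γ (f (b+1))) = ∅
      rcases hstep a with e | ⟨e1, e2⟩ <;> rcases hstep b with e' | ⟨e1', e2'⟩
      · rw [e, e']
        exact (hseg (f a) (f b) hfab).2 (fun h => h1 (hsucc _ _ h)) (fun h => h2 (hsucc _ _ h))
      · rw [e, e1', e2', Set.inter_comm]
        refine hdis _ (e1' ▸ hfab) (fun h => h1 (hsucc _ _ (e1'.trans h.symm))) (hf1 a) (hf2 a) ?_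
        intro h
        exact h2 (hfinj (h.trans e2'.symm))
      · rw [e', e1, e2]
        refine hdis _ (e1 ▸ hfab.symm) (fun h => h2 (hsucc _ _ (e1.trans h.symm))) (hf1 b) (hf2 b) ?_
        intro h
        exact h1 (hfinj (h.trans e2.symm))
      · exact absurd (e1.trans e1'.symm) hfab
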